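/- Consider the limiting regime n, d → ∞ with d²/(n log n) → ρ for some ρ ∈ [0,∞]. Then P(PR_n(W^×)) → 1 if ρ > 8, and P(PR_n(W^×)) → 0 if ρ < 8. -/

import Mathlib

open MeasureTheory ProbabilityTheory Filter Topology Matrix

noncomputable section


/-- The law `N(0, I_d/d)` on `ℝ^d`. -/
def stdGaussianVec (d : ℕ) : Measure (Fin d → ℝ) :=
  Measure.pi fun _ => gaussianReal 0 (d : NNReal)⁻¹

/-- The Gaussian model: `u_1, …, u_n, v_1, …, v_n` mutually independent `N(0, I_d/d)`. -/
def gaussianModel (d n : ℕ) :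
    Measure ((Fin n → Fin d → ℝ) × (Fin n → Fin d → ℝ)) :=
  (Measure.pi fun _ : Fin n => stdGaussianVec d).prod
    (Measure.pi fun _ : Fin n => stdGaussianVec d)

/-- The correlation matrix memory `W^× = U Vᵀ = Σ_i u_i v_iᵀ`. -/
def Wcross {d n : ℕ} (u v : Fin n → Fin d → ℝ) : Matrix (Fin d) (Fin d) ℝ :=
  Matrix.of fun a b => ∑ i, u i a * v i b

/-- The score `s_{j,i} = u_j^⊤ W^× v_i` under the correlation matrix memory. -/
def scoreX {d n : ℕ} (u v : Fin n → Fin d → ℝ) (j i : Fin n) : ℝ :=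
  u j ⬝ᵥ (Wcross u v).mulVec (v i)

/-- The top-1 retrieval event for correlation matrix memory `W^×`. -/
def PRcross (d n : ℕ) : Set ((Fin n → Fin d → ℝ) × (Fin n → Fin d → ℝ)) :=
  {p | ∀ i j : Fin n, j ≠ i → scoreX p.1 p.2 j i < scoreX p.1 p.2 i i}

instance instProbStd (d : ℕ) : IsProbabilityMeasure (stdGaussianVec d) := by
  unfold stdGaussianVec; infer_instance

/-- iid Gaussian vectors. -/
def piG (d n : ℕ) : Measure (Fin n → Fin d → ℝ) := Measure.pi fun _ : Fin n => stdGaussianVec d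

instance instProbPiG (d n : ℕ) : IsProbabilityMeasure (piG d n) := by
  unfold piG; infer_instance

lemma gaussianModel_eq (d n : ℕ) : gaussianModel d n = (piG d n).prod (piG d n) := rfl

instance instProbModel (d n : ℕ) : IsProbabilityMeasure (gaussianModel d n) := by
  rw [gaussianModel_eq]; infer_instance

lemma mono_real {Ω : Type*} [MeasurableSpace Ω] {P : Measure Ω} [IsProbabilityMeasure P]
    {s t : Set Ω} (h : ∀ x, x ∈ s → x ∈ t) : P.real s ≤ P.real t := measureReal_mono h

lemma sum_gauss {Ω ι : Type*} [MeasurableSpace Ω] {P : Measure Ω} [IsProbabilityMeasure P]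
    {X : ι → Ω → ℝ} {v : ι → NNReal}
    (hm : ∀ i, Measurable (X i)) (hi : iIndepFun X P) (hl : ∀ i, P.map (X i) = gaussianReal 0 (v i))
    (S : Finset ι) :
    P.map (fun ω => ∑ i ∈ S, X i ω) = gaussianReal 0 (∑ i ∈ S, v i) := by
  classical
  induction S using Finset.induction_on with
  | empty => simp [Measure.map_const]
  | insert a S ha ih =>
    have h1 : IndepFun (X a) (∑ j ∈ S, X j) P :=
      (hi.indepFun_finsetSum_of_notMem hm ha).symm
    have h2 : (fun ω => ∑ i ∈ insert a S, X i ω) = X a + ∑ j ∈ S, X j := by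
      ext ω; simp [Finset.sum_insert ha]
    have h3 : (fun ω => ∑ i ∈ S, X i ω) = ∑ j ∈ S, X j := by ext ω; simp
    rw [h3] at ih
    rw [h2, gaussianReal_add_gaussianReal_of_indepFun h1 (hl a) ih, Finset.sum_insert ha]
    simp

lemma law_dot {d : ℕ} (a : Fin d → ℝ) :
    (stdGaussianVec d).map (fun x => a ⬝ᵥ x) = gaussianReal 0 (Real.toNNReal (a ⬝ᵥ a / d)) := by
  unfold stdGaussianVec
  have hi : iIndepFun (fun (i : Fin d) (ω : Fin d → ℝ) => a i * ω i)
      (Measure.pi fun _ : Fin d => gaussianReal 0 (d : NNReal)⁻¹) :=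
    iIndepFun_pi (X := fun i (x : ℝ) => a i * x) (fun i => by fun_prop)
  have hl : ∀ i, (Measure.pi fun _ : Fin d => gaussianReal 0 (d : NNReal)⁻¹).map
      (fun ω : Fin d → ℝ => a i * ω i) = gaussianReal 0 (Real.toNNReal (a i * a i / d)) := by
    intro i
    have := gaussianReal_map_const_mul (μ := 0) (v := (d : NNReal)⁻¹) (a i)
    rw [← (measurePreserving_eval (fun _ : Fin d => gaussianReal 0 (d : NNReal)⁻¹) i).map_eq,
      Measure.map_map (by fun_prop) (by fun_prop)] at this
    refine Eq.trans (show _ = _ from this) ?_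
    rw [mul_zero]
    congr 1
    apply NNReal.coe_injective
    rw [Real.coe_toNNReal _ (div_nonneg (mul_self_nonneg _) (by positivity))]
    simp
    ring
  have := sum_gauss (fun i => by fun_prop) hi hl Finset.univ
  rw [← Real.toNNReal_sum_of_nonneg (fun i _ => div_nonneg (mul_self_nonneg _) (by positivity)),
    ← Finset.sum_div] at this
  exact this

lemma dot_self_nonneg' {d : ℕ} (a : Fin d → ℝ) : 0 ≤ a ⬝ᵥ a :=
  Finset.sum_nonneg fun _ _ => mul_self_nonneg _

@[fun_prop]
lemma measurable_dot {Ω : Type*} [MeasurableSpace Ω] {d : ℕ} {f g : Ω → Fin d → ℝ} (hf : Measurable f) (hg : Measurable g) :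
    Measurable (fun x => f x ⬝ᵥ g x) := by
  unfold dotProduct; fun_prop

lemma law_lin {d n : ℕ} (a : Fin n → Fin d → ℝ) (S : Finset (Fin n)) :
    (piG d n).map (fun x => ∑ k ∈ S, a k ⬝ᵥ x k) =
      gaussianReal 0 (Real.toNNReal ((∑ k ∈ S, a k ⬝ᵥ a k) / d)) := by
  have hm : ∀ k, Measurable (fun x : Fin d → ℝ => a k ⬝ᵥ x) := fun k =>
    measurable_dot (by fun_prop) (by fun_prop)
  have hi : iIndepFun (fun (k : Fin n) (ω : Fin n → Fin d → ℝ) => a k ⬝ᵥ ω k) (piG d n) :=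
    iIndepFun_pi (X := fun k (x : Fin d → ℝ) => a k ⬝ᵥ x) (fun k => (hm k).aemeasurable)
  have hl : ∀ k, (piG d n).map (fun ω => a k ⬝ᵥ ω k) =
      gaussianReal 0 (Real.toNNReal (a k ⬝ᵥ a k / d)) := by
    intro k
    rw [← law_dot,
      ← (measurePreserving_eval (fun _ : Fin n => stdGaussianVec d) k).map_eq,
      Measure.map_map (hm k) (by fun_prop)]
    rfl
  have := sum_gauss (fun k => (hm k).comp (measurable_pi_apply k)) hi hl S
  rw [← Real.toNNReal_sum_of_nonneg (fun i _ => div_nonneg (dot_self_nonneg' _) (by positivity)),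
    ← Finset.sum_div] at this
  exact this

lemma gauss_tail {v : NNReal} {V τ : ℝ} (hv : (v : ℝ) ≤ V) (hV : 0 < V) (hτ : 0 ≤ τ) :
    (gaussianReal 0 v).real {x | τ ≤ |x|} ≤ 2 * Real.exp (-τ ^ 2 / (2 * V)) := by
  have key : ∀ w : ℝ, w = τ / V → Real.exp (-w * τ) * Real.exp (v * w ^ 2 / 2) ≤ Real.exp (-τ ^ 2 / (2 * V)) := by
    rintro w rfl
    rw [← Real.exp_add]
    apply Real.exp_le_exp.mpr
    have : (v : ℝ) * (τ / V) ^ 2 ≤ V * (τ / V) ^ 2 := by gcongr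
    have e1 : V * (τ / V) ^ 2 = τ ^ 2 / V := by field_simp
    have e2 : -(τ / V) * τ + τ ^ 2 / V / 2 = -τ ^ 2 / (2 * V) := by field_simp; ring
    linarith
  have h1 : (gaussianReal 0 v).real {x | τ ≤ x} ≤ Real.exp (-τ ^ 2 / (2 * V)) := by
    have := measure_ge_le_exp_mul_mgf (μ := gaussianReal 0 v) (X := id) (t := τ / V) τ (by positivity)
      (by simpa using integrable_exp_mul_gaussianReal (μ := 0) (v := v) (τ / V))
    rw [mgf_id_gaussianReal] at this
    simp only [zero_mul, zero_add, id] at this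
    exact this.trans (key _ rfl)
  have h2 : (gaussianReal 0 v).real {x | x ≤ -τ} ≤ Real.exp (-τ ^ 2 / (2 * V)) := by
    have := measure_le_le_exp_mul_mgf (μ := gaussianReal 0 v) (X := id) (t := -(τ / V)) (-τ)
      (by simp; positivity)
      (by simpa using integrable_exp_mul_gaussianReal (μ := 0) (v := v) (-(τ / V)))
    rw [mgf_id_gaussianReal] at this
    simp only [zero_mul, zero_add, id] at this
    refine this.trans (le_trans (le_of_eq ?_) (key _ rfl))
    congr 2 <;> ring
  have h3 : {x : ℝ | τ ≤ |x|} ⊆ {x | τ ≤ x} ∪ {x | x ≤ -τ} := by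
    intro x hx
    simp only [Set.mem_ofPred_eq, Set.mem_union] at *
    rcases le_abs.mp hx with h | h
    · exact Or.inl h
    · right; linarith
  calc _ ≤ _ := measureReal_mono h3
    _ ≤ _ := measureReal_union_le _ _
    _ ≤ _ := by linarith

/-- Gaussian lower tail bound. -/
lemma gauss_lower {x : ℝ} (hx : 0 ≤ x) :
    Real.exp (-(x + 1) ^ 2 / 2) / 3 ≤ (gaussianReal 0 1).real {y | x ≤ y} := by
  have h0 : (gaussianReal 0 1).real (Set.Icc x (x + 1)) ≤ (gaussianReal 0 1).real {y | x ≤ y} :=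
    measureReal_mono (fun y hy => hy.1)
  refine le_trans ?_ h0
  rw [measureReal_def, gaussianReal_apply_eq_integral 0 one_ne_zero,
    ENNReal.toReal_ofReal (integral_nonneg fun _ => gaussianPDFReal_nonneg _ _ _)]
  have h1 : ∫ y in Set.Icc x (x + 1), (Real.exp (-(x + 1) ^ 2 / 2) / 3) =
      Real.exp (-(x + 1) ^ 2 / 2) / 3 := by
    simp
  rw [← h1]
  apply setIntegral_mono_on
  · simp
  · exact (integrable_gaussianPDFReal 0 1).integrableOn
  · exact measurableSet_Icc
  · intro y hy
    rw [gaussianPDFReal_def, div_eq_inv_mul]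
    have hs : √(2 * Real.pi * ((1 : NNReal) : ℝ)) ≤ 3 := by
      rw [Real.sqrt_le_left (by norm_num)]
      have := Real.pi_lt_four
      simp; linarith
    have hy0 : 0 ≤ y := hx.trans hy.1
    apply mul_le_mul
    · apply inv_anti₀ _ hs
      have := Real.pi_pos
      apply Real.sqrt_pos.mpr
      simp; positivity
    · apply Real.exp_le_exp.mpr
      simp
      have := hy.2
      nlinarith
    · positivity
    · positivity


lemma gauss_sq_mgf {v : NNReal} (hv : v ≠ 0) {θ : ℝ} (hθ : 2 * θ * v < 1) :
    Integrable (fun x : ℝ => Real.exp (θ * x ^ 2)) (gaussianReal 0 v) ∧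
    ∫ x, Real.exp (θ * x ^ 2) ∂(gaussianReal 0 v) = (√(1 - 2 * θ * v))⁻¹ := by
  have hv' : (0 : ℝ) < v := by positivity
  have hb : 0 < (1 / (2 * v) - θ : ℝ) := by
    rw [sub_pos, lt_div_iff₀ (by positivity)]; linarith
  have he : ∀ x : ℝ, gaussianPDFReal 0 v x * Real.exp (θ * x ^ 2) =
      (√(2 * Real.pi * v))⁻¹ * Real.exp (-(1 / (2 * v) - θ) * x ^ 2) := by
    intro x
    rw [gaussianPDFReal_def]
    simp only []
    rw [mul_assoc, ← Real.exp_add]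
    congr 2
    field_simp
    ring
  constructor
  · rw [gaussianReal_of_var_ne_zero 0 hv]
    unfold gaussianPDF
    rw [integrable_withDensity_iff_integrable_smul' (by fun_prop) (by simp)]
    simp_rw [ENNReal.toReal_ofReal (gaussianPDFReal_nonneg _ _ _), smul_eq_mul, he]
    exact (integrable_exp_neg_mul_sq hb).const_mul _
  · rw [integral_gaussianReal_eq_integral_smul hv]
    simp_rw [smul_eq_mul, he]
    rw [integral_const_mul, integral_gaussian]
    rw [← Real.sqrt_inv, ← Real.sqrt_inv, ← Real.sqrt_mul (by have := Real.pi_pos; positivity)]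
    congr 1
    have := Real.pi_pos
    have h3 : 1 - 2 * θ * v ≠ 0 := by linarith
    have h4 : (1 / (2 * v) - θ : ℝ) = (1 - 2 * θ * v) / (2 * v) := by field_simp
    rw [h4]
    field_simp

section chi
variable {Ω ι : Type*} [MeasurableSpace Ω] {P : Measure Ω} [IsProbabilityMeasure P]
    {X : ι → Ω → ℝ} {v : NNReal}

lemma chi_mgf (hv : v ≠ 0)
    (hm : ∀ i, Measurable (X i)) (hi : iIndepFun X P) (hl : ∀ i, P.map (X i) = gaussianReal 0 v)
    (S : Finset ι) {θ : ℝ} (hθ : 2 * θ * v < 1) :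
    Integrable (fun ω => Real.exp (θ * (∑ i ∈ S, X i ω ^ 2))) P ∧
    mgf (fun ω => ∑ i ∈ S, X i ω ^ 2) P θ = ((√(1 - 2 * θ * v))⁻¹) ^ S.card := by
  obtain ⟨h1, h2⟩ := gauss_sq_mgf hv hθ
  have hi' : iIndepFun (fun i ω => X i ω ^ 2) P :=
    hi.comp (fun _ x => x ^ 2) (fun _ => by fun_prop)
  have hm' : ∀ i, Measurable (fun ω => X i ω ^ 2) := fun i => (hm i).pow_const 2
  have hint : ∀ i, Integrable (fun ω => Real.exp (θ * X i ω ^ 2)) P := by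
    intro i
    rw [← hl i] at h1
    exact (integrable_map_measure (by fun_prop) (hm i).aemeasurable).mp h1
  have hs : (fun ω => ∑ i ∈ S, X i ω ^ 2) = ∑ i ∈ S, fun ω => X i ω ^ 2 := by ext; simp
  constructor
  · have := hi'.integrable_exp_mul_sum hm' (s := S) (t := θ) (fun i _ => hint i)
    simpa using this
  · rw [hs, hi'.mgf_sum hm']
    rw [← Finset.prod_const]
    apply Finset.prod_congr rfl
    intro i _
    rw [← h2, ← hl i, integral_map (hm i).aemeasurable (by fun_prop)]
    rfl

lemma chi_upper (hv : v ≠ 0)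
    (hm : ∀ i, Measurable (X i)) (hi : iIndepFun X P) (hl : ∀ i, P.map (X i) = gaussianReal 0 v)
    (S : Finset ι) {N : ℕ} (hN : S.card ≤ N) {δ : ℝ} (h0 : 0 < δ) (h1 : δ ≤ 1) :
    P.real {ω | (1 + δ) * v * N < ∑ i ∈ S, X i ω ^ 2} ≤ Real.exp (-δ ^ 2 * N / 16) := by
  have hv' : (0 : ℝ) < v := by positivity
  have hθv : 2 * (δ / (8 * v)) * v = δ / 4 := by field_simp; norm_num
  obtain ⟨a, b⟩ := chi_mgf hv hm hi hl S (θ := δ / (8 * v)) (by rw [hθv]; linarith)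
  rw [hθv] at b
  have hc := measure_ge_le_exp_mul_mgf (μ := P) ((1 + δ) * v * N) (t := δ / (8 * v)) (by positivity) a
  rw [b] at hc
  refine le_trans ?_ (hc.trans ?_)
  · apply mono_real
    intro ω hω
    simp only [Set.mem_ofPred_eq] at *
    exact hω.le
  have e1 : -(δ / (8 * v)) * ((1 + δ) * v * N) = -(δ * (1 + δ) / 8 * N) := by field_simp
  rw [e1]
  have hlog : (√(1 - δ / 4))⁻¹ ≤ Real.exp (δ / 8 + δ ^ 2 / 16) := by
    rw [inv_le_comm₀ (Real.sqrt_pos.mpr (by linarith)) (Real.exp_pos _), ← Real.exp_neg]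
    apply Real.le_sqrt_of_sq_le
    rw [← Real.exp_nat_mul]
    rw [← Real.le_log_iff_exp_le (by linarith)]
    have := Real.one_sub_inv_le_log_of_pos (x := 1 - δ / 4) (by linarith)
    have h5 : 1 - (1 - δ / 4)⁻¹ = - (δ / 4) / (1 - δ / 4) := by
      have : 1 - δ / 4 ≠ 0 := by linarith
      rw [eq_div_iff this, sub_mul, inv_mul_cancel₀ this]; ring
    refine le_trans ?_ this
    rw [h5, le_div_iff₀ (by linarith)]
    push_cast
    nlinarith [mul_pos h0 h0]
  have h1' : 1 ≤ Real.exp (δ / 8 + δ ^ 2 / 16) := Real.one_le_exp (by positivity)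
  calc _ ≤ Real.exp (-(δ * (1 + δ) / 8 * N)) * Real.exp (δ / 8 + δ ^ 2 / 16) ^ N := by
        gcongr
        calc _ ≤ Real.exp (δ / 8 + δ ^ 2 / 16) ^ S.card := by gcongr
          _ ≤ _ := pow_le_pow_right₀ h1' hN
    _ = _ := by
        rw [← Real.exp_nat_mul, ← Real.exp_add]; congr 1; ring

lemma chi_lower (hv : v ≠ 0)
    (hm : ∀ i, Measurable (X i)) (hi : iIndepFun X P) (hl : ∀ i, P.map (X i) = gaussianReal 0 v)
    (S : Finset ι) {δ : ℝ} (h0 : 0 < δ) (h1 : δ ≤ 1) :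
    P.real {ω | ∑ i ∈ S, X i ω ^ 2 < (1 - δ) * v * S.card} ≤ Real.exp (-δ ^ 2 * S.card / 16) := by
  refine le_trans ?_ (show Real.exp (-δ ^ 2 * S.card / 8) ≤ Real.exp (-δ ^ 2 * S.card / 16) by
    apply Real.exp_le_exp.mpr
    have : 0 ≤ δ ^ 2 * S.card := by positivity
    linarith)
  have hv' : (0 : ℝ) < v := by positivity
  have hθv : 2 * (-δ / (2 * v)) * v = -δ := by field_simp
  obtain ⟨a, b⟩ := chi_mgf hv hm hi hl S (θ := -δ / (2 * v)) (by rw [hθv]; linarith)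
  rw [hθv] at b
  have hc := measure_le_le_exp_mul_mgf (μ := P) ((1 - δ) * v * S.card) (t := -δ / (2 * v))
    (by apply div_nonpos_of_nonpos_of_nonneg <;> [linarith; positivity]) a
  rw [b] at hc
  refine le_trans ?_ (hc.trans ?_)
  · apply mono_real
    intro ω hω
    simp only [Set.mem_ofPred_eq] at *
    exact hω.le
  have e1 : -(-δ / (2 * v)) * ((1 - δ) * v * S.card) = (δ * (1 - δ) / 2 * S.card) := by field_simp
  rw [e1]
  have hlog : (√(1 - -δ))⁻¹ ≤ Real.exp (-δ / 2 + 3 * δ ^ 2 / 8) := by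
    rw [inv_le_comm₀ (Real.sqrt_pos.mpr (by linarith)) (Real.exp_pos _), ← Real.exp_neg]
    apply Real.le_sqrt_of_sq_le
    rw [← Real.exp_nat_mul]
    rw [← Real.le_log_iff_exp_le (by linarith)]
    have := Real.le_log_one_add_of_nonneg (x := δ) h0.le
    rw [sub_neg_eq_add]
    refine le_trans ?_ this
    rw [le_div_iff₀ (by linarith)]
    push_cast
    nlinarith [mul_pos h0 h0, mul_pos (mul_pos h0 h0) h0]
  calc _ ≤ Real.exp ((δ * (1 - δ) / 2 * S.card)) * Real.exp (-δ / 2 + 3 * δ ^ 2 / 8) ^ S.card := by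
        gcongr
    _ = _ := by
        rw [← Real.exp_nat_mul, ← Real.exp_add]; congr 1; ring
end chi

lemma fub_prod {α β : Type*} [MeasurableSpace α] [MeasurableSpace β] {μ : Measure α} {ν : Measure β}
    [IsProbabilityMeasure μ] [IsProbabilityMeasure ν] {E : Set (α × β)} (hE : MeasurableSet E) {c : ℝ}
    (hc : ∀ x, ν.real {y | (x, y) ∈ E} ≤ c) : (μ.prod ν).real E ≤ c := by
  rw [measureReal_def, Measure.prod_apply hE]
  have hμ := IsProbabilityMeasure.ne_zero μ
  have hx : Nonempty α := by
    by_contra h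
    rw [not_nonempty_iff] at h
    exact hμ (Measure.eq_zero_of_isEmpty μ)
  have hc0 : 0 ≤ c := measureReal_nonneg.trans (hc hx.some)
  apply ENNReal.toReal_le_of_le_ofReal hc0
  calc _ ≤ ∫⁻ _, ENNReal.ofReal c ∂μ := by
        apply lintegral_mono
        intro x
        rw [ENNReal.le_ofReal_iff_toReal_le (measure_ne_top _ _) hc0]
        exact hc x
    _ = _ := by simp

lemma fub_prod' {α β : Type*} [MeasurableSpace α] [MeasurableSpace β] {μ : Measure α} {ν : Measure β}
    [IsProbabilityMeasure μ] [IsProbabilityMeasure ν] {E : Set (α × β)} (hE : MeasurableSet E) {c : ℝ}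
    (hc : ∀ y, μ.real {x | (x, y) ∈ E} ≤ c) : (μ.prod ν).real E ≤ c := by
  have h := (Measure.measurePreserving_swap (μ := ν) (ν := μ))
  rw [← h.measureReal_preimage hE.nullMeasurableSet]
  exact fub_prod (h.measurable hE) hc

lemma pi_piecewise {E : Type*} [MeasurableSpace E] {n : ℕ} (γ : Measure E) [IsProbabilityMeasure γ]
    (S : Finset (Fin n)) :
    MeasurePreserving (fun p : (Fin n → E) × (Fin n → E) => S.piecewise p.1 p.2)
      ((Measure.pi fun _ => γ).prod (Measure.pi fun _ => γ)) (Measure.pi fun _ => γ) := by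
  have hm : Measurable (fun p : (Fin n → E) × (Fin n → E) => S.piecewise p.1 p.2) := by
    rw [measurable_pi_iff]
    intro i
    by_cases h : i ∈ S
    · simp only [Finset.piecewise_eq_of_mem _ _ _ h]; fun_prop
    · simp only [Finset.piecewise_eq_of_notMem _ _ _ h]; fun_prop
  refine ⟨hm, ?_⟩
  symm
  apply Measure.pi_eq
  intro s hs
  rw [Measure.map_apply hm (MeasurableSet.univ_pi hs)]
  have : (fun p : (Fin n → E) × (Fin n → E) => S.piecewise p.1 p.2) ⁻¹' (Set.univ.pi s) =
      (Set.univ.pi fun i => if i ∈ S then s i else Set.univ) ×ˢ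
      (Set.univ.pi fun i => if i ∈ S then Set.univ else s i) := by
    ext p
    simp only [Set.mem_preimage, Set.mem_univ_pi, Set.mem_prod]
    rw [← forall_and]
    apply forall_congr'
    intro i
    by_cases h : i ∈ S <;> simp [h]
  rw [this, Measure.prod_prod, Measure.pi_pi, Measure.pi_pi, ← Finset.prod_mul_distrib]
  apply Finset.prod_congr rfl
  intro i _
  by_cases h : i ∈ S <;> simp [h]

lemma fub_pi {d n : ℕ} (S : Finset (Fin n)) {E : Set (Fin n → Fin d → ℝ)} (hE : MeasurableSet E) {c : ℝ}
    (hc : ∀ y, (piG d n).real {x | S.piecewise x y ∈ E} ≤ c) : (piG d n).real E ≤ c := by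
  have h := pi_piecewise (stdGaussianVec d) S
  unfold piG at *
  rw [← h.measureReal_preimage hE.nullMeasurableSet]
  exact fub_prod' (h.measurable hE) hc

lemma pi_marg {d n : ℕ} (i : Fin n) {E : Set (Fin d → ℝ)} (hE : MeasurableSet E) :
    (piG d n).real {x | x i ∈ E} = (stdGaussianVec d).real E :=
  (measurePreserving_eval (fun _ : Fin n => stdGaussianVec d) i).measureReal_preimage
    hE.nullMeasurableSet

/-- Law of a linear combination of iid Gaussian vectors. -/
lemma law_comb {d n : ℕ} (g : Fin n → ℝ) (S : Finset (Fin n)) :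
    (piG d n).map (fun x => ∑ k ∈ S, g k • x k) =
      (stdGaussianVec d).map (fun x => √(∑ k ∈ S, g k ^ 2) • x) := by
  have hm1 : Measurable (fun x : Fin n → Fin d → ℝ => ∑ k ∈ S, g k • x k) := by fun_prop
  have hm2 : Measurable (fun x : Fin d → ℝ => √(∑ k ∈ S, g k ^ 2) • x) := by fun_prop
  have := Measure.isProbabilityMeasure_map (μ := piG d n) hm1.aemeasurable
  have := Measure.isProbabilityMeasure_map (μ := stdGaussianVec d) hm2.aemeasurable
  apply Measure.ext_of_charFunDual
  ext L
  rw [charFunDual_eq_charFun_map_one, charFunDual_eq_charFun_map_one]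
  congr 1
  rw [Measure.map_map (by fun_prop) hm1, Measure.map_map (by fun_prop) hm2]
  set b : Fin d → ℝ := fun i => L (Pi.single i 1) with hb
  have hL : ∀ x, L x = b ⬝ᵥ x := by
    intro x
    have hx : x = ∑ i, x i • (Pi.single i (1 : ℝ) : Fin d → ℝ) := by
      ext j; simp [Finset.sum_apply, Pi.single_apply]
    conv_lhs => rw [hx]
    rw [map_sum]
    simp [dotProduct, hb, mul_comm]
  have e1 : (L ∘ fun x : Fin n → Fin d → ℝ => ∑ k ∈ S, g k • x k) =
      fun x => ∑ k ∈ S, (g k • b) ⬝ᵥ x k := by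
    ext x
    simp [hL, dotProduct_sum]
  have e2 : (L ∘ fun x : Fin d → ℝ => √(∑ k ∈ S, g k ^ 2) • x) =
      fun x => (√(∑ k ∈ S, g k ^ 2) • b) ⬝ᵥ x := by
    ext x; simp [hL]
  rw [e1, e2, law_lin, law_dot]
  congr 3
  simp only [smul_dotProduct, dotProduct_smul, smul_eq_mul]
  rw [← mul_assoc, Real.mul_self_sqrt (Finset.sum_nonneg fun _ _ => sq_nonneg _), Finset.sum_mul]
  exact Finset.sum_congr rfl fun _ _ => by ring


lemma meas_and {α : Type*} [MeasurableSpace α] {p q : α → Prop} (h : MeasurableSet {x | p x})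
    (h' : MeasurableSet {x | q x}) : MeasurableSet {x | p x ∧ q x} := h.inter h'

lemma inv_d_ne {d : ℕ} (hd : 0 < d) : ((d : NNReal)⁻¹) ≠ 0 := by positivity

lemma coord_facts (d : ℕ) :
    (∀ i : Fin d, Measurable (fun x : Fin d → ℝ => x i)) ∧
    iIndepFun (fun (i : Fin d) (x : Fin d → ℝ) => x i) (stdGaussianVec d) ∧
    ∀ i : Fin d, (stdGaussianVec d).map (fun x => x i) = gaussianReal 0 (d : NNReal)⁻¹ := by
  refine ⟨fun i => by fun_prop, ?_, fun i => ?_⟩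
  · exact iIndepFun_pi (X := fun _ (x : ℝ) => x) (fun i => by fun_prop)
  · exact (measurePreserving_eval (fun _ : Fin d => gaussianReal 0 (d : NNReal)⁻¹) i).map_eq

lemma norm_upper {d : ℕ} (hd : 0 < d) {δ : ℝ} (h0 : 0 < δ) (h1 : δ ≤ 1) :
    (stdGaussianVec d).real {x | 1 + δ < x ⬝ᵥ x} ≤ Real.exp (-δ ^ 2 * d / 16) := by
  obtain ⟨a, b, c⟩ := coord_facts d
  have := chi_upper (inv_d_ne hd) a b c Finset.univ (N := d) (by simp) h0 h1
  refine le_trans (mono_real ?_) this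
  intro x hx
  simp only [Set.mem_ofPred_eq, dotProduct, NNReal.coe_inv, NNReal.coe_natCast] at *
  have hd' : (0 : ℝ) < d := by positivity
  rw [mul_assoc, inv_mul_cancel₀ hd'.ne', mul_one]
  simpa [sq] using hx

lemma norm_lower {d : ℕ} (hd : 0 < d) {δ : ℝ} (h0 : 0 < δ) (h1 : δ ≤ 1) :
    (stdGaussianVec d).real {x | x ⬝ᵥ x < 1 - δ} ≤ Real.exp (-δ ^ 2 * d / 16) := by
  obtain ⟨a, b, c⟩ := coord_facts d
  have := chi_lower (inv_d_ne hd) a b c Finset.univ h0 h1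
  rw [Finset.card_univ, Fintype.card_fin] at this
  refine le_trans (mono_real ?_) this
  intro x hx
  simp only [Set.mem_ofPred_eq, dotProduct, NNReal.coe_inv, NNReal.coe_natCast] at *
  have hd' : (0 : ℝ) < d := by positivity
  rw [mul_assoc, inv_mul_cancel₀ hd'.ne', mul_one]
  simpa [sq] using hx

lemma dot_facts {d n : ℕ} (a : Fin d → ℝ) :
    (∀ k : Fin n, Measurable (fun x : Fin n → Fin d → ℝ => a ⬝ᵥ x k)) ∧
    iIndepFun (fun (k : Fin n) (x : Fin n → Fin d → ℝ) => a ⬝ᵥ x k) (piG d n) ∧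
    ∀ k : Fin n, (piG d n).map (fun x => a ⬝ᵥ x k) = gaussianReal 0 (Real.toNNReal (a ⬝ᵥ a / d)) := by
  refine ⟨fun i => by fun_prop, ?_, fun i => ?_⟩
  · exact iIndepFun_pi (X := fun _ (x : Fin d → ℝ) => a ⬝ᵥ x) (fun i => by fun_prop)
  · have := law_lin (n := n) (fun _ => a) {i}
    simpa using this

lemma sumsq_upper {d n : ℕ} (hd : 0 < d) (a : Fin d → ℝ) (S : Finset (Fin n)) {N : ℕ} (hN : S.card ≤ N)
    {δ : ℝ} (h0 : 0 < δ) (h1 : δ ≤ 1) :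
    (piG d n).real {x | (1 + δ) * (a ⬝ᵥ a / d) * N < ∑ k ∈ S, (a ⬝ᵥ x k) ^ 2} ≤
      Real.exp (-δ ^ 2 * N / 16) := by
  have hd' : (0 : ℝ) < d := by positivity
  rcases (dot_self_nonneg' a).eq_or_lt with h | h
  · have ha : a = 0 := dotProduct_self_eq_zero.mp h.symm
    subst ha
    simp
    positivity
  · obtain ⟨e, b, c⟩ := dot_facts (n := n) a
    have hp : 0 < a ⬝ᵥ a / d := by positivity
    have := chi_upper (Real.toNNReal_pos.mpr hp).ne' e b c S hN h0 h1
    rwa [Real.coe_toNNReal _ hp.le] at this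

lemma sumsq_lower {d n : ℕ} (hd : 0 < d) (a : Fin d → ℝ) (S : Finset (Fin n))
    {δ : ℝ} (h0 : 0 < δ) (h1 : δ ≤ 1) :
    (piG d n).real {x | ∑ k ∈ S, (a ⬝ᵥ x k) ^ 2 < (1 - δ) * (a ⬝ᵥ a / d) * S.card} ≤
      Real.exp (-δ ^ 2 * S.card / 16) := by
  have hd' : (0 : ℝ) < d := by positivity
  rcases (dot_self_nonneg' a).eq_or_lt with h | h
  · have ha : a = 0 := dotProduct_self_eq_zero.mp h.symm
    subst ha
    simp
    positivity
  · obtain ⟨e, b, c⟩ := dot_facts (n := n) a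
    have hp : 0 < a ⬝ᵥ a / d := by positivity
    have := chi_lower (Real.toNNReal_pos.mpr hp).ne' e b c S h0 h1
    rwa [Real.coe_toNNReal _ hp.le] at this

lemma lin_tail {d n : ℕ} (a : Fin n → Fin d → ℝ) (S : Finset (Fin n)) {V τ : ℝ}
    (hV : 0 < V) (hτ : 0 ≤ τ) (h : (∑ k ∈ S, a k ⬝ᵥ a k) / d ≤ V) :
    (piG d n).real {x | τ ≤ |∑ k ∈ S, a k ⬝ᵥ x k|} ≤ 2 * Real.exp (-τ ^ 2 / (2 * V)) := by
  have h1 := law_lin a S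
  have h2 := gauss_tail (v := Real.toNNReal ((∑ k ∈ S, a k ⬝ᵥ a k) / d)) (V := V) (τ := τ)
    (by rw [Real.coe_toNNReal']; exact max_le h hV.le) hV hτ
  rw [← h1, map_measureReal_apply (by fun_prop)
    (measurableSet_le (by fun_prop) (by fun_prop))] at h2
  exact h2

lemma comb_lower {d n : ℕ} (hd : 0 < d) (g : Fin n → ℝ) (S : Finset (Fin n))
    {δ : ℝ} (h0 : 0 < δ) (h1 : δ ≤ 1) :
    (piG d n).real {x | (∑ k ∈ S, g k • x k) ⬝ᵥ (∑ k ∈ S, g k • x k) < (1 - δ) * ∑ k ∈ S, g k ^ 2} ≤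
      Real.exp (-δ ^ 2 * d / 16) := by
  have hm : MeasurableSet {z : Fin d → ℝ | z ⬝ᵥ z < (1 - δ) * ∑ k ∈ S, g k ^ 2} :=
    measurableSet_lt (by fun_prop) (by fun_prop)
  have e : (piG d n).real {x | (∑ k ∈ S, g k • x k) ⬝ᵥ (∑ k ∈ S, g k • x k) < (1 - δ) * ∑ k ∈ S, g k ^ 2}
      = ((piG d n).map (fun x => ∑ k ∈ S, g k • x k)).real
        {z : Fin d → ℝ | z ⬝ᵥ z < (1 - δ) * ∑ k ∈ S, g k ^ 2} := by
    rw [map_measureReal_apply (by fun_prop) hm]; rfl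
  rw [e, law_comb, map_measureReal_apply (by fun_prop) hm]
  refine le_trans (mono_real ?_) (norm_lower hd h0 h1)
  intro x hx
  have hs : 0 ≤ ∑ k ∈ S, g k ^ 2 := Finset.sum_nonneg fun _ _ => sq_nonneg _
  simp only [Set.mem_ofPred_eq, Set.mem_preimage, smul_dotProduct, dotProduct_smul, smul_eq_mul,
    ← mul_assoc, Real.mul_self_sqrt hs] at *
  by_contra hcon
  nlinarith

/-- The main quadratic form. -/
def Qf {d n : ℕ} (D : Finset (Fin n)) (i j : Fin n) (u v : Fin n → Fin d → ℝ) : ℝ :=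
  ∑ k ∈ D, (v k ⬝ᵥ v i) * ((u i - u j) ⬝ᵥ u k)

lemma marg_fst {d n : ℕ} {E : Set (Fin n → Fin d → ℝ)} :
    (gaussianModel d n).real {p | p.1 ∈ E} = (piG d n).real E := by
  rw [gaussianModel_eq]
  have : {p : (Fin n → Fin d → ℝ) × (Fin n → Fin d → ℝ) | p.1 ∈ E} = E ×ˢ Set.univ := by
    ext; simp
  rw [this, measureReal_prod_prod]; simp

lemma marg_snd {d n : ℕ} {E : Set (Fin n → Fin d → ℝ)} :
    (gaussianModel d n).real {p | p.2 ∈ E} = (piG d n).real E := by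
  rw [gaussianModel_eq]
  have : {p : (Fin n → Fin d → ℝ) × (Fin n → Fin d → ℝ) | p.2 ∈ E} = Set.univ ×ˢ E := by
    ext; simp
  rw [this, measureReal_prod_prod]; simp

lemma ev_dot {d n : ℕ} (hd : 0 < d) {i j : Fin n} (hij : i ≠ j) {δ : ℝ} (h0 : 0 < δ) :
    (piG d n).real {u | u i ⬝ᵥ u i ≤ 2 ∧ δ ≤ |u i ⬝ᵥ u j|} ≤ 2 * Real.exp (-δ ^ 2 * d / 16) := by
  have hd' : (0 : ℝ) < d := by positivity
  apply fub_pi {j}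
  · apply meas_and <;> apply measurableSet_le <;> fun_prop
  intro y
  by_cases hy : y i ⬝ᵥ y i ≤ 2
  · have := lin_tail (n := n) (fun _ => y i) {j} (V := 2 / d) (τ := δ) (by positivity) h0.le
      (by simp; gcongr)
    refine le_trans (mono_real ?_) (this.trans ?_)
    · intro x hx
      simp [hij] at hx ⊢
      exact hx.2
    · apply mul_le_mul_of_nonneg_left _ (by norm_num)
      apply Real.exp_le_exp.mpr
      have : 0 < δ ^ 2 * d := by positivity
      have e : -δ ^ 2 / (2 * (2 / (d : ℝ))) = - (δ ^ 2 * d) / 4 := by field_simp; norm_num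
      rw [e]; linarith
  · simp [hij, hy]
    positivity

lemma ev_sum {d n : ℕ} (hd : 0 < d) {i j : Fin n} (D : Finset (Fin n)) {δ : ℝ} (h0 : 0 < δ) (h1 : δ ≤ 1) :
    (piG d n).real {u | (1 + δ) * ((u i - u j) ⬝ᵥ (u i - u j) / d) * D.card <
      ∑ k ∈ (D.erase i).erase j, ((u i - u j) ⬝ᵥ u k) ^ 2} ≤ Real.exp (-δ ^ 2 * D.card / 16) := by
  apply fub_pi ((D.erase i).erase j)
  · exact (measurableSet_lt (by fun_prop) (by fun_prop))
  intro y
  refine le_trans (mono_real ?_) (sumsq_upper hd (y i - y j) ((D.erase i).erase j) (N := D.card)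
    (Finset.card_le_card ((Finset.erase_subset _ _).trans (Finset.erase_subset _ _))) h0 h1)
  intro x hx
  have hi : i ∉ (D.erase i).erase j := by simp
  have hj : j ∉ (D.erase i).erase j := by simp
  simp only [Set.mem_ofPred_eq, Finset.piecewise_eq_of_notMem _ _ _ hi,
    Finset.piecewise_eq_of_notMem _ _ _ hj] at *
  refine hx.trans_eq (Finset.sum_congr rfl fun k hk => ?_)
  rw [Finset.piecewise_eq_of_mem _ _ _ hk]

lemma ev_lin {d n : ℕ} {i j : Fin n} (D : Finset (Fin n)) {V τ : ℝ} (hV : 0 < V) (hτ : 0 ≤ τ) :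
    (gaussianModel d n).real {p |
      (∑ k ∈ D.erase i, ((p.1 i - p.1 j) ⬝ᵥ p.1 k) ^ 2) * (p.2 i ⬝ᵥ p.2 i) / d ≤ V ∧
      τ ≤ |∑ k ∈ D.erase i, (p.2 k ⬝ᵥ p.2 i) * ((p.1 i - p.1 j) ⬝ᵥ p.1 k)|} ≤
      2 * Real.exp (-τ ^ 2 / (2 * V)) := by
  rw [gaussianModel_eq]
  apply fub_prod
  · apply meas_and <;> apply measurableSet_le <;> fun_prop
  intro u
  apply fub_pi (D.erase i)
  · apply meas_and <;> apply measurableSet_le <;> fun_prop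
  intro y
  have hi : i ∉ D.erase i := by simp
  by_cases hy : (∑ k ∈ D.erase i, ((u i - u j) ⬝ᵥ u k) ^ 2) * (y i ⬝ᵥ y i) / d ≤ V
  · refine le_trans (mono_real ?_) (lin_tail (fun k => ((u i - u j) ⬝ᵥ u k) • y i) (D.erase i) hV hτ ?_)
    · intro x hx
      simp only [Set.mem_ofPred_eq, Finset.piecewise_eq_of_notMem _ _ _ hi] at *
      refine hx.2.trans_eq (congrArg _ (Finset.sum_congr rfl fun k hk => ?_))
      rw [Finset.piecewise_eq_of_mem _ _ _ hk, smul_dotProduct, dotProduct_comm, smul_eq_mul, mul_comm]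
    · refine le_trans (le_of_eq ?_) hy
      simp only [smul_dotProduct, dotProduct_smul, smul_eq_mul]
      rw [Finset.sum_mul]
      congr 1
      exact Finset.sum_congr rfl fun _ _ => by ring
  · simp only [Set.mem_ofPred_eq, Finset.piecewise_eq_of_notMem _ _ _ hi, hy, false_and]
    simp
    positivity


/-- Variance proxy. -/
def Vf (δ : ℝ) (d N : ℕ) : ℝ := 18 / d + (1 + 2 * δ) ^ 3 * (2 * N) / d ^ 2

lemma Qf_split {d n : ℕ} {D : Finset (Fin n)} {i j : Fin n} (hi : i ∈ D) (u v : Fin n → Fin d → ℝ) :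
    Qf D i j u v = (v i ⬝ᵥ v i) * (u i ⬝ᵥ u i - u i ⬝ᵥ u j) +
      ∑ k ∈ D.erase i, (v k ⬝ᵥ v i) * ((u i - u j) ⬝ᵥ u k) := by
  unfold Qf
  rw [← Finset.add_sum_erase _ _ hi, sub_dotProduct, dotProduct_comm (u j) (u i)]

lemma sumc_split {d n : ℕ} {D : Finset (Fin n)} {i j : Fin n} (hij : i ≠ j) (hj : j ∈ D)
    (u : Fin n → Fin d → ℝ) :
    ∑ k ∈ D.erase i, ((u i - u j) ⬝ᵥ u k) ^ 2 = (u i ⬝ᵥ u j - u j ⬝ᵥ u j) ^ 2 +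
      ∑ k ∈ (D.erase i).erase j, ((u i - u j) ⬝ᵥ u k) ^ 2 := by
  rw [← Finset.add_sum_erase (D.erase i) _ (Finset.mem_erase.mpr ⟨hij.symm, hj⟩), sub_dotProduct]

lemma alg_var {δ α β ω ν T : ℝ} {d N : ℕ} (hd : (0 : ℝ) < d) (h0 : 0 < δ) (h1 : δ ≤ 1 / 2)
    (hα : α ≤ 1 + δ) (hβ : β ≤ 1 + δ) (hβ0 : 0 ≤ β) (hν : ν ≤ 1 + δ) (hν0 : 0 ≤ ν) (hω : |ω| < δ)
    (hT : T ≤ (1 + δ) * ((α - 2 * ω + β) / d) * N) (hT0 : 0 ≤ T) :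
    ((ω - β) ^ 2 + T) * ν / d ≤ Vf δ d N := by
  obtain ⟨w1, w2⟩ := abs_lt.mp hω
  have e1 : (ω - β) ^ 2 ≤ 4 := by nlinarith
  have e2 : T ≤ (1 + δ) * (2 * (1 + 2 * δ)) * N / d := by
    refine hT.trans ?_
    rw [← mul_div_assoc, div_mul_eq_mul_div]
    gcongr
    linarith
  have e3 : ((ω - β) ^ 2 + T) * ν ≤ (4 + (1 + δ) * (2 * (1 + 2 * δ)) * N / d) * (1 + δ) := by
    gcongr
  unfold Vf
  have hN : (0 : ℝ) ≤ N / d := by positivity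
  have e4 : (4 + (1 + δ) * (2 * (1 + 2 * δ)) * N / d) * (1 + δ) ≤ 18 + (1 + 2 * δ) ^ 3 * 2 * (N / d) := by
    have : (1 + δ) * (2 * (1 + 2 * δ)) * N / d * (1 + δ) = ((1 + δ) ^ 2 * (1 + 2 * δ)) * 2 * (N / d) := by
      ring
    rw [add_mul, this]
    have h5 : (1 + δ) ^ 2 * (1 + 2 * δ) ≤ (1 + 2 * δ) ^ 3 := by
      have : (1 + δ) ^ 2 ≤ (1 + 2 * δ) ^ 2 := by gcongr; linarith
      nlinarith
    have : (1 + δ) ^ 2 * (1 + 2 * δ) * 2 * (N / d) ≤ (1 + 2 * δ) ^ 3 * 2 * (N / d) := by gcongr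
    linarith
  calc _ ≤ (18 + (1 + 2 * δ) ^ 3 * 2 * (N / d)) / d := by gcongr; exact e3.trans e4
    _ = _ := by field_simp

lemma alg_main {δ α ω ν : ℝ} (h0 : 0 < δ) (h1 : δ ≤ 1 / 2)
    (hα : α ≤ 1 + δ) (hα' : 1 - δ ≤ α) (hν : ν ≤ 1 + δ) (hν0 : 1 - δ ≤ ν) (hω : |ω| < δ) :
    |ν * (α - ω) - 1| ≤ 5 * δ := by
  obtain ⟨w1, w2⟩ := abs_lt.mp hω
  have a1 : α - ω ≤ 1 + 2 * δ := by linarith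
  have a2 : 1 - 2 * δ ≤ α - ω := by linarith
  rw [abs_le]
  constructor
  · have : (1 - δ) * (1 - 2 * δ) ≤ ν * (α - ω) :=
      mul_le_mul hν0 a2 (by linarith) (by linarith)
    nlinarith
  · have : ν * (α - ω) ≤ (1 + δ) * (1 + 2 * δ) :=
      mul_le_mul hν a1 (by linarith) (by linarith)
    nlinarith

lemma union2 {Ω : Type*} [MeasurableSpace Ω] {P : Measure Ω} [IsProbabilityMeasure P]
    {s t : Set Ω} {a b : ℝ} (hs : P.real s ≤ a) (ht : P.real t ≤ b) : P.real (s ∪ t) ≤ a + b :=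
  (measureReal_union_le _ _).trans (add_le_add hs ht)

lemma meas_upper {d : ℕ} (c : ℝ) : MeasurableSet {x : Fin d → ℝ | c < x ⬝ᵥ x} :=
  measurableSet_lt (by fun_prop) (by fun_prop)

lemma meas_lower {d : ℕ} (c : ℝ) : MeasurableSet {x : Fin d → ℝ | x ⬝ᵥ x < c} :=
  measurableSet_lt (by fun_prop) (by fun_prop)

lemma key {d n : ℕ} (hd : 0 < d) {D : Finset (Fin n)} {i j : Fin n} (hij : i ≠ j) (hi : i ∈ D) (hj : j ∈ D)
    {δ τ : ℝ} (h0 : 0 < δ) (h1 : δ ≤ 1 / 2) (hτ : 0 ≤ τ) :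
    (gaussianModel d n).real {p | 5 * δ + τ ≤ |Qf D i j p.1 p.2 - 1|} ≤
      7 * Real.exp (-δ ^ 2 * d / 16) + Real.exp (-δ ^ 2 * D.card / 16) +
        2 * Real.exp (-τ ^ 2 / (2 * Vf δ d D.card)) := by
  have hd' : (0 : ℝ) < d := by positivity
  have hV : 0 < Vf δ d D.card := by unfold Vf; positivity
  have h1' : δ ≤ 1 := by linarith
  have U := norm_upper hd h0 h1'
  have Lo := norm_lower hd h0 h1'
  have b1 : (gaussianModel d n).real {p | p.1 ∈ {u | u i ∈ {x | 1 + δ < x ⬝ᵥ x}}} ≤ Real.exp (-δ ^ 2 * d / 16) := by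
    rw [marg_fst, pi_marg _ (meas_upper _)]; exact U
  have b2 : (gaussianModel d n).real {p | p.1 ∈ {u | u i ∈ {x | x ⬝ᵥ x < 1 - δ}}} ≤ Real.exp (-δ ^ 2 * d / 16) := by
    rw [marg_fst, pi_marg _ (meas_lower _)]; exact Lo
  have b3 : (gaussianModel d n).real {p | p.1 ∈ {u | u j ∈ {x | 1 + δ < x ⬝ᵥ x}}} ≤ Real.exp (-δ ^ 2 * d / 16) := by
    rw [marg_fst, pi_marg _ (meas_upper _)]; exact U
  have b4 : (gaussianModel d n).real {p | p.2 ∈ {u | u i ∈ {x | 1 + δ < x ⬝ᵥ x}}} ≤ Real.exp (-δ ^ 2 * d / 16) := by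
    rw [marg_snd, pi_marg _ (meas_upper _)]; exact U
  have b5 : (gaussianModel d n).real {p | p.2 ∈ {u | u i ∈ {x | x ⬝ᵥ x < 1 - δ}}} ≤ Real.exp (-δ ^ 2 * d / 16) := by
    rw [marg_snd, pi_marg _ (meas_lower _)]; exact Lo
  have b6 := (marg_fst (d := d) (n := n)).trans_le (ev_dot hd hij h0)
  have b7 := (marg_fst (d := d) (n := n)).trans_le (ev_sum hd (i := i) (j := j) D h0 h1')
  have b8 := ev_lin (d := d) (i := i) (j := j) D hV hτ
  have B := union2 (union2 (union2 (union2 (union2 (union2 (union2 b1 b2) b3) b4) b5) b6) b7) b8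
  refine le_trans (mono_real ?_) (B.trans (le_of_eq (by ring)))
  rintro ⟨u, v⟩ hp
  by_contra hcon
  simp only [Set.mem_ofPred_eq, Set.mem_union, not_or, not_and, not_lt, not_le] at hp hcon
  obtain ⟨⟨⟨⟨⟨⟨⟨c1, c2⟩, c3⟩, c4⟩, c5⟩, c6⟩, c7⟩, c8⟩ := hcon
  have c6' := c6 (by linarith)
  have hvar : (∑ k ∈ D.erase i, ((u i - u j) ⬝ᵥ u k) ^ 2) * (v i ⬝ᵥ v i) / d ≤ Vf δ d D.card := by
    rw [sumc_split hij hj]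
    refine alg_var hd' h0 h1 c1 c3 (dot_self_nonneg' _) c4 (dot_self_nonneg' _) c6' ?_
      (Finset.sum_nonneg fun _ _ => sq_nonneg _)
    refine c7.trans (le_of_eq ?_)
    rw [sub_dotProduct, dotProduct_sub, dotProduct_sub, dotProduct_comm (u j) (u i)]
    ring
  have c8' := c8 hvar
  have m := alg_main h0 h1 c1 c2 c4 c5 c6'
  rw [Qf_split hi] at hp
  have tri := abs_add_le ((v i ⬝ᵥ v i) * (u i ⬝ᵥ u i - u i ⬝ᵥ u j) - 1)
    (∑ k ∈ D.erase i, (v k ⬝ᵥ v i) * ((u i - u j) ⬝ᵥ u k))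
  rw [sub_add_eq_add_sub] at tri
  linarith

/-- The vector `W_C v_i`. -/
def wf {d n : ℕ} (C : Finset (Fin n)) (g : Fin n → ℝ) (u : Fin n → Fin d → ℝ) : Fin d → ℝ :=
  ∑ k ∈ C, g k • u k

lemma wbound {d n : ℕ} (hd : 0 < d) {C : Finset (Fin n)} {i : Fin n} (hi : i ∉ C)
    {δ : ℝ} (h0 : 0 < δ) (h1 : δ ≤ 1 / 2) :
    (gaussianModel d n).real {p | wf C (fun k => p.2 k ⬝ᵥ p.2 i) p.1 ⬝ᵥ wf C (fun k => p.2 k ⬝ᵥ p.2 i) p.1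
      < (1 - δ) ^ 3 * C.card / d} ≤
      2 * Real.exp (-δ ^ 2 * d / 16) + Real.exp (-δ ^ 2 * C.card / 16) := by
  have hd' : (0 : ℝ) < d := by positivity
  have h1' : δ ≤ 1 := by linarith
  have b1 : (gaussianModel d n).real {p | p.2 ∈ {u | u i ∈ {x | x ⬝ᵥ x < 1 - δ}}} ≤ Real.exp (-δ ^ 2 * d / 16) := by
    rw [marg_snd, pi_marg _ (meas_lower _)]; exact norm_lower hd h0 h1'
  have b2 : (gaussianModel d n).real {p | p.2 ∈ {v | ∑ k ∈ C, (v i ⬝ᵥ v k) ^ 2 <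
      (1 - δ) * (v i ⬝ᵥ v i / d) * C.card}} ≤ Real.exp (-δ ^ 2 * C.card / 16) := by
    rw [marg_snd]
    apply fub_pi C
    · exact (measurableSet_lt (by fun_prop) (by fun_prop))
    intro y
    refine le_trans (mono_real ?_) (sumsq_lower hd (y i) C h0 h1')
    intro x hx
    simp only [Set.mem_ofPred_eq, Finset.piecewise_eq_of_notMem _ _ _ hi] at *
    refine lt_of_eq_of_lt (Finset.sum_congr rfl fun k hk => ?_) hx
    rw [Finset.piecewise_eq_of_mem _ _ _ hk]
  have b3 : (gaussianModel d n).real {p | wf C (fun k => p.2 k ⬝ᵥ p.2 i) p.1 ⬝ᵥ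
      wf C (fun k => p.2 k ⬝ᵥ p.2 i) p.1 < (1 - δ) * ∑ k ∈ C, (p.2 k ⬝ᵥ p.2 i) ^ 2} ≤
      Real.exp (-δ ^ 2 * d / 16) := by
    rw [gaussianModel_eq]
    apply fub_prod'
    · unfold wf
      exact (measurableSet_lt (by fun_prop) (by fun_prop))
    intro v
    exact comb_lower hd (fun k => v k ⬝ᵥ v i) C h0 h1'
  refine le_trans (mono_real ?_) ((union2 (union2 b1 b2) b3).trans (le_of_eq (by ring)))
  rintro ⟨u, v⟩ hp
  by_contra hcon
  simp only [Set.mem_ofPred_eq, Set.mem_union, not_or, not_lt] at hp hcon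
  obtain ⟨⟨c1, c2⟩, c3⟩ := hcon
  have e : ∑ k ∈ C, (v k ⬝ᵥ v i) ^ 2 = ∑ k ∈ C, (v i ⬝ᵥ v k) ^ 2 :=
    Finset.sum_congr rfl fun k _ => by rw [dotProduct_comm]
  rw [e] at c3
  have hδ : 0 ≤ 1 - δ := by linarith
  have : (1 - δ) ^ 3 * C.card / d ≤ (1 - δ) * ∑ k ∈ C, (v i ⬝ᵥ v k) ^ 2 := by
    calc (1 - δ) ^ 3 * C.card / d = (1 - δ) * ((1 - δ) * ((1 - δ) / d) * C.card) := by ring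
      _ ≤ (1 - δ) * ((1 - δ) * (v i ⬝ᵥ v i / d) * C.card) := by gcongr
      _ ≤ _ := by gcongr
  linarith

/-- Lower bound for Gaussian tail. -/
def qf (x : ℝ) : ℝ := Real.exp (-(x + 1) ^ 2 / 2) / 3

lemma single {d : ℕ} (hd : 0 < d) {w : Fin d → ℝ} {r t : ℝ} (hr : 0 < r) (ht : 0 ≤ t) (hw : r ≤ w ⬝ᵥ w) :
    (stdGaussianVec d).real {x | w ⬝ᵥ x < t} ≤ 1 - qf (t * √d / √r) := by
  have hd' : (0 : ℝ) < d := by positivity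
  set s : ℝ := √(w ⬝ᵥ w / d) with hs
  have hsp : 0 < s := Real.sqrt_pos.mpr (div_pos (hr.trans_le hw) hd')
  have hlaw : (stdGaussianVec d).map (fun x => w ⬝ᵥ x) = (gaussianReal 0 1).map (fun x => s * x) := by
    rw [law_dot, gaussianReal_map_const_mul, mul_zero]
    congr 1
    apply NNReal.coe_injective
    rw [Real.coe_toNNReal _ (div_nonneg (dot_self_nonneg' _) hd'.le)]
    have h7 : s ^ 2 = w ⬝ᵥ w / d := Real.sq_sqrt (div_nonneg (dot_self_nonneg' w) hd'.le)
    rw [← h7]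
    clear_value s
    simp
  have e : (stdGaussianVec d).real {x | w ⬝ᵥ x < t} = (gaussianReal 0 1).real {x | s * x < t} := by
    have hm : MeasurableSet {y : ℝ | y < t} := measurableSet_lt measurable_id measurable_const
    have : ((stdGaussianVec d).map (fun x => w ⬝ᵥ x)).real {y : ℝ | y < t} =
      ((gaussianReal 0 1).map (fun x => s * x)).real {y : ℝ | y < t} := by rw [hlaw]
    rwa [map_measureReal_apply (by fun_prop) hm, map_measureReal_apply (by fun_prop) hm] at this
  have hx0 : 0 ≤ t * √d / √r := by positivity
  have h2 := gauss_lower hx0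
  have h3 : (gaussianReal 0 1).real {y | t * √d / √r ≤ y} = 1 - (gaussianReal 0 1).real {y | y < t * √d / √r} := by
    have : {y : ℝ | t * √d / √r ≤ y} = {y | y < t * √d / √r}ᶜ := by ext; simp
    have hm : MeasurableSet {y : ℝ | y < t * √d / √r} := measurableSet_lt measurable_id measurable_const
    rw [this, probReal_compl_eq_one_sub hm]
  have h4 : (gaussianReal 0 1).real {x | s * x < t} ≤ (gaussianReal 0 1).real {y | y < t * √d / √r} := by
    apply mono_real
    intro x hx
    simp only [Set.mem_ofPred_eq] at *
    have h5 : x < t / s := by rw [lt_div_iff₀ hsp]; linarith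
    refine h5.trans_le ?_
    have h6 : √r / √d ≤ s := by
      rw [hs, ← Real.sqrt_div hr.le]; gcongr
    calc t / s ≤ t / (√r / √d) := by gcongr
      _ = _ := by field_simp
  rw [e]
  unfold qf
  linarith

lemma box {d n : ℕ} (S : Finset (Fin n)) (w : Fin n → Fin d → ℝ) {t q : ℝ}
    (hw : ∀ i ∈ S, (stdGaussianVec d).real {x | w i ⬝ᵥ x < t} ≤ 1 - q) :
    (piG d n).real {x | ∀ i ∈ S, w i ⬝ᵥ x i < t} ≤ (1 - q) ^ S.card := by
  have e : {x : Fin n → Fin d → ℝ | ∀ i ∈ S, w i ⬝ᵥ x i < t} =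
      Set.univ.pi fun i => if i ∈ S then {x | w i ⬝ᵥ x < t} else Set.univ := by
    ext x
    simp only [Set.mem_ofPred_eq, Set.mem_univ_pi]
    apply forall_congr'
    intro i
    by_cases h : i ∈ S <;> simp [h]
  rw [e, measureReal_def, piG, Measure.pi_pi, ENNReal.toReal_prod]
  calc _ = ∏ i, (if i ∈ S then (stdGaussianVec d).real {x | w i ⬝ᵥ x < t} else 1) := by
        apply Finset.prod_congr rfl
        intro i _
        by_cases h : i ∈ S <;> simp [h, measureReal_def]
    _ = ∏ i ∈ S, (stdGaussianVec d).real {x | w i ⬝ᵥ x < t} := by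
        rw [Finset.prod_ite_mem]; simp
    _ ≤ ∏ i ∈ S, (1 - q) := Finset.prod_le_prod (fun _ _ => measureReal_nonneg) hw
    _ = _ := by simp

lemma wf_piecewise {d n : ℕ} {C S : Finset (Fin n)} (h : Disjoint S C) (g : Fin n → ℝ)
    (x y : Fin n → Fin d → ℝ) : wf C g (S.piecewise x y) = wf C g y := by
  unfold wf
  apply Finset.sum_congr rfl
  intro k hk
  rw [Finset.piecewise_eq_of_notMem _ _ _ (fun hs => Finset.disjoint_left.mp h hs hk)]

lemma meas_ball {α ι : Type*} [MeasurableSpace α] (S : Finset ι) {p : ι → α → Prop}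
    (h : ∀ i ∈ S, MeasurableSet {x | p i x}) : MeasurableSet {x | ∀ i ∈ S, p i x} := by
  have : {x | ∀ i ∈ S, p i x} = ⋂ i ∈ S, {x | p i x} := by ext; simp
  rw [this]
  exact S.measurableSet_biInter h

lemma meas_bex {α ι : Type*} [MeasurableSpace α] (S : Finset ι) {p : ι → α → Prop}
    (h : ∀ i ∈ S, MeasurableSet {x | p i x}) : MeasurableSet {x | ∃ i ∈ S, p i x} := by
  have : {x | ∃ i ∈ S, p i x} = ⋃ i ∈ S, {x | p i x} := by ext; simp
  rw [this]
  exact S.measurableSet_biUnion h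

lemma Hbound {d n : ℕ} (hd : 0 < d) {A B C : Finset (Fin n)} (hAB : Disjoint B A) (hAC : Disjoint A C)
    (hBC : Disjoint B C) (g : Fin n → Fin n → ℝ) {r t : ℝ} (hr : 0 < r) (ht : 0 ≤ t) :
    (piG d n).real {u | (∀ i ∈ A, r ≤ wf C (g i) u ⬝ᵥ wf C (g i) u) ∧
      ∀ i ∈ A, ∀ j ∈ B, wf C (g i) u ⬝ᵥ u j - wf C (g i) u ⬝ᵥ u i < 2 * t} ≤
    (1 - qf (t * √d / √r)) ^ A.card + (1 - qf (t * √d / √r)) ^ B.card := by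
  have hq1 : 0 ≤ 1 - qf (t * √d / √r) := by
    unfold qf
    have : Real.exp (-(t * √d / √r + 1) ^ 2 / 2) ≤ 1 :=
      Real.exp_le_one_iff.mpr (by have := sq_nonneg (t * √d / √r + 1); linarith)
    linarith
  have b1 : (piG d n).real {u | (∀ i ∈ A, r ≤ wf C (g i) u ⬝ᵥ wf C (g i) u) ∧
      ∀ i ∈ A, -t < wf C (g i) u ⬝ᵥ u i} ≤ (1 - qf (t * √d / √r)) ^ A.card := by
    apply fub_pi A
    · unfold wf
      exact meas_and (meas_ball _ fun i _ => measurableSet_le (by fun_prop) (by fun_prop))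
        (meas_ball _ fun i _ => measurableSet_lt (by fun_prop) (by fun_prop))
    intro y
    by_cases hy : ∀ i ∈ A, r ≤ wf C (g i) y ⬝ᵥ wf C (g i) y
    · refine le_trans (mono_real ?_) (box A (fun i => -wf C (g i) y) (t := t) fun i hi =>
        single hd hr ht (by simpa using hy i hi))
      intro x hx
      simp only [Set.mem_ofPred_eq, wf_piecewise hAC] at *
      intro i hi
      have := hx.2 i hi
      rw [Finset.piecewise_eq_of_mem _ _ _ hi] at this
      rw [neg_dotProduct]
      linarith
    · simp only [Set.mem_ofPred_eq, wf_piecewise hAC, hy, false_and]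
      simp
      positivity
  have b2 : (piG d n).real {u | (∀ i ∈ A, r ≤ wf C (g i) u ⬝ᵥ wf C (g i) u) ∧
      (∃ i ∈ A, wf C (g i) u ⬝ᵥ u i ≤ -t) ∧
      ∀ i ∈ A, ∀ j ∈ B, wf C (g i) u ⬝ᵥ u j - wf C (g i) u ⬝ᵥ u i < 2 * t} ≤
      (1 - qf (t * √d / √r)) ^ B.card := by
    apply fub_pi B
    · unfold wf
      exact meas_and (meas_ball _ fun i _ => measurableSet_le (by fun_prop) (by fun_prop))
        (meas_and (meas_bex _ fun i _ => measurableSet_le (by fun_prop) (by fun_prop))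
          (meas_ball _ fun i _ => meas_ball _ fun j _ => measurableSet_lt (by fun_prop) (by fun_prop)))
    intro y
    by_cases hy : (∀ i ∈ A, r ≤ wf C (g i) y ⬝ᵥ wf C (g i) y) ∧ (∃ i ∈ A, wf C (g i) y ⬝ᵥ y i ≤ -t)
    · obtain ⟨hy1, i, hi, hit⟩ := hy
      refine le_trans (mono_real ?_) (box B (fun _ => wf C (g i) y) (t := t) fun _ _ =>
        single hd hr ht (hy1 i hi))
      intro x hx
      simp only [Set.mem_ofPred_eq, wf_piecewise hBC] at *
      intro j hj
      have := hx.2.2 i hi j hj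
      rw [Finset.piecewise_eq_of_mem _ _ _ hj,
        Finset.piecewise_eq_of_notMem _ _ _ (fun h => Finset.disjoint_left.mp hAB h hi)] at this
      linarith
    · refine le_trans (le_of_eq ?_) (pow_nonneg hq1 _)
      convert measureReal_empty
      ext x
      simp only [Set.mem_ofPred_eq, wf_piecewise hBC, Set.mem_empty_iff_false, iff_false]
      rintro ⟨h1, ⟨i, hi, h2⟩, -⟩
      rw [Finset.piecewise_eq_of_notMem _ _ _ (fun h => Finset.disjoint_left.mp hAB h hi)] at h2
      exact hy ⟨h1, i, hi, h2⟩
  refine le_trans (mono_real ?_) (union2 b1 b2)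
  intro u hu
  simp only [Set.mem_ofPred_eq, Set.mem_union] at *
  by_cases h : ∃ i ∈ A, wf C (g i) u ⬝ᵥ u i ≤ -t
  · exact Or.inr ⟨hu.1, h, hu.2⟩
  · left
    push Not at h
    exact ⟨hu.1, h⟩


lemma score_eq {d n : ℕ} (u v : Fin n → Fin d → ℝ) (j i : Fin n) :
    scoreX u v j i = ∑ k, (v k ⬝ᵥ v i) * (u j ⬝ᵥ u k) := by
  unfold scoreX
  have h : (Wcross u v).mulVec (v i) = ∑ k, (v k ⬝ᵥ v i) • u k := by
    ext a
    simp only [Wcross, Matrix.mulVec, dotProduct, Matrix.of_apply, Finset.sum_apply, Pi.smul_apply,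
      smul_eq_mul, Finset.sum_mul]
    rw [Finset.sum_comm]
    refine Finset.sum_congr rfl fun k _ => Finset.sum_congr rfl fun b _ => by ring
  rw [h, dotProduct_sum]
  simp [dotProduct_smul]

lemma score_sub {d n : ℕ} (u v : Fin n → Fin d → ℝ) (j i : Fin n) :
    scoreX u v i i - scoreX u v j i = Qf Finset.univ i j u v := by
  rw [score_eq, score_eq, Qf, ← Finset.sum_sub_distrib]
  refine Finset.sum_congr rfl fun k _ => ?_
  rw [sub_dotProduct]; ring

lemma score_sub' {d n : ℕ} (D C : Finset (Fin n)) (h : Cᶜ = D) (u v : Fin n → Fin d → ℝ) (j i : Fin n) :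
    scoreX u v i i - scoreX u v j i = Qf D i j u v +
      (wf C (fun k => v k ⬝ᵥ v i) u ⬝ᵥ u i - wf C (fun k => v k ⬝ᵥ v i) u ⬝ᵥ u j) := by
  rw [score_sub, Qf, ← Finset.sum_add_sum_compl C, h, Qf, add_comm]
  congr 1
  rw [wf, sum_dotProduct, sum_dotProduct, ← Finset.sum_sub_distrib]
  refine Finset.sum_congr rfl fun k _ => ?_
  rw [smul_dotProduct, smul_dotProduct, sub_dotProduct, dotProduct_comm (u i), dotProduct_comm (u j)]
  simp only [smul_eq_mul]; ring

lemma union_fin {Ω ι : Type*} [MeasurableSpace Ω] {P : Measure Ω} [IsProbabilityMeasure P]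
    (S : Finset ι) {E : ι → Set Ω} {a : ℝ} (h : ∀ i ∈ S, P.real (E i) ≤ a) :
    P.real (⋃ i ∈ S, E i) ≤ S.card * a := by
  refine (measureReal_biUnion_finset_le _ _).trans ?_
  refine (Finset.sum_le_sum h).trans ?_
  simp

/-- Bound for the failure probability of a pair. -/
def kb (δ τ : ℝ) (d N : ℕ) : ℝ := 7 * Real.exp (-δ ^ 2 * d / 16) + Real.exp (-δ ^ 2 * N / 16) +
        2 * Real.exp (-τ ^ 2 / (2 * Vf δ d N))

lemma upper_bd {d n : ℕ} (hd : 0 < d) {δ : ℝ} (h0 : 0 < δ) (h1 : δ ≤ 1 / 5) :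
    (gaussianModel d n).real (PRcross d n)ᶜ ≤ n ^ 2 * kb δ (1 - 5 * δ) d n := by
  set S : Finset (Fin n × Fin n) := Finset.univ.filter fun x => x.1 ≠ x.2 with hS
  have hkb : 0 ≤ kb δ (1 - 5 * δ) d n := by unfold kb; positivity
  have := union_fin (P := gaussianModel d n) S
    (E := fun x => {p | 5 * δ + (1 - 5 * δ) ≤ |Qf Finset.univ x.1 x.2 p.1 p.2 - 1|})
    (a := kb δ (1 - 5 * δ) d n) (by
      intro x hx
      have := key hd (D := Finset.univ) (i := x.1) (j := x.2) (by simpa [hS] using hx) (Finset.mem_univ _)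
        (Finset.mem_univ _) h0 (by linarith) (τ := 1 - 5 * δ) (by linarith)
      simpa [kb] using this)
  refine le_trans (mono_real ?_) (this.trans ?_)
  · rintro ⟨u, v⟩ hp
    simp only [PRcross, Set.mem_compl_iff, Set.mem_ofPred_eq] at hp
    push Not at hp
    obtain ⟨i, j, hij, hp⟩ := hp
    simp only [Set.mem_iUnion, Set.mem_ofPred_eq]
    refine ⟨(i, j), by simp [hS, hij.symm], ?_⟩
    have := score_sub u v j i
    simp only
    rw [← this, abs_of_nonpos] <;> linarith
  · have hc : (S.card : ℝ) ≤ n ^ 2 := by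
      have : S.card ≤ n ^ 2 := by
        refine (Finset.card_filter_le _ _).trans ?_
        simp [sq]
      exact_mod_cast this
    gcongr

lemma lower_bd {d n m c : ℕ} (hd : 0 < d) (hc : 0 < c) (hn : c + 2 * m = n) {δ : ℝ} (h0 : 0 < δ) (h1 : δ ≤ 1 / 2) :
    (gaussianModel d n).real (PRcross d n) ≤
      2 * (1 - qf ((1 + 6 * δ) / 2 * √d / √((1 - δ) ^ 3 * c / d))) ^ m + m ^ 2 * kb δ δ d (2 * m) +
      m * (2 * Real.exp (-δ ^ 2 * d / 16) + Real.exp (-δ ^ 2 * c / 16)) := by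
  obtain ⟨A, hA⟩ := Finset.exists_subset_card_eq (s := (Finset.univ : Finset (Fin n))) (n := m) (by simp; omega)
  obtain ⟨B, hB⟩ := Finset.exists_subset_card_eq (s := Aᶜ) (n := m) (by
    rw [Finset.card_compl, hA.2, Fintype.card_fin]; omega)
  have hBA : Disjoint B A := Finset.disjoint_left.mpr fun x hx => by simpa using hB.1 hx
  set C := (A ∪ B)ᶜ with hC
  have hcA : A.card = m := hA.2
  have hcB : B.card = m := hB.2
  have hcAB : (A ∪ B).card = 2 * m := by
    rw [Finset.card_union_of_disjoint hBA.symm]; omega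
  have hcC : C.card = c := by
    rw [hC, Finset.card_compl, hcAB, Fintype.card_fin]; omega
  have hAC : Disjoint A C := Finset.disjoint_left.mpr fun x hx => by simp [hC, hx]
  have hBC : Disjoint B C := Finset.disjoint_left.mpr fun x hx => by simp [hC, hx]
  have hr : 0 < (1 - δ) ^ 3 * c / d := by
    have : 0 < 1 - δ := by linarith
    positivity
  have b1 : (gaussianModel d n).real {p | (∀ i ∈ A, (1 - δ) ^ 3 * c / d ≤
        wf C (fun k => p.2 k ⬝ᵥ p.2 i) p.1 ⬝ᵥ wf C (fun k => p.2 k ⬝ᵥ p.2 i) p.1) ∧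
      ∀ i ∈ A, ∀ j ∈ B, wf C (fun k => p.2 k ⬝ᵥ p.2 i) p.1 ⬝ᵥ p.1 j -
        wf C (fun k => p.2 k ⬝ᵥ p.2 i) p.1 ⬝ᵥ p.1 i < 2 * ((1 + 6 * δ) / 2)} ≤
      2 * (1 - qf ((1 + 6 * δ) / 2 * √d / √((1 - δ) ^ 3 * c / d))) ^ m := by
    rw [gaussianModel_eq]
    apply fub_prod'
    · unfold wf
      exact meas_and (meas_ball _ fun i _ => measurableSet_le (by fun_prop) (by fun_prop))
          (meas_ball _ fun i _ => meas_ball _ fun j _ => measurableSet_lt (by fun_prop) (by fun_prop))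
    intro v
    refine (Hbound hd hBA hAC hBC (fun i k => v k ⬝ᵥ v i) hr (t := (1 + 6 * δ) / 2) (by positivity)).trans ?_
    rw [hcA, hcB, two_mul]
  have b2 := union_fin (P := gaussianModel d n) (A ×ˢ B)
    (E := fun x => {p | 5 * δ + δ ≤ |Qf (A ∪ B) x.1 x.2 p.1 p.2 - 1|})
    (a := kb δ δ d (2 * m)) (by
      intro x hx
      obtain ⟨hx1, hx2⟩ := Finset.mem_product.mp hx
      have := key hd (D := A ∪ B) (i := x.1) (j := x.2)
        (fun h => Finset.disjoint_left.mp hBA hx2 (h ▸ hx1)) (Finset.mem_union_left _ hx1)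
        (Finset.mem_union_right _ hx2) h0 h1 h0.le
      rw [hcAB] at this
      exact this)
  have b3 := union_fin (P := gaussianModel d n) A
    (E := fun i => {p | wf C (fun k => p.2 k ⬝ᵥ p.2 i) p.1 ⬝ᵥ wf C (fun k => p.2 k ⬝ᵥ p.2 i) p.1
      < (1 - δ) ^ 3 * c / d})
    (a := 2 * Real.exp (-δ ^ 2 * d / 16) + Real.exp (-δ ^ 2 * c / 16)) (by
      intro i hi
      have := wbound hd (C := C) (i := i) (Finset.disjoint_left.mp hAC hi) h0 h1
      rw [hcC] at this
      exact this)
  refine le_trans (mono_real ?_) ((union2 (union2 b1 b2) b3).trans (le_of_eq ?_))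
  · rintro ⟨u, v⟩ hp
    by_contra hcon
    simp only [PRcross, Set.mem_ofPred_eq, Set.mem_union, Set.mem_iUnion, not_or, not_exists, not_lt,
      not_le, Finset.mem_product, and_imp, Prod.forall] at hp hcon
    obtain ⟨⟨c1, c2⟩, c3⟩ := hcon
    refine c1 ⟨c3, fun i hi j hj => ?_⟩
    have e := score_sub' (A ∪ B) C (by simp [hC]) u v j i
    have e1 := hp i j (fun h => Finset.disjoint_left.mp hBA hj (h ▸ hi))
    have e2 := (abs_lt.mp (c2 i j hi hj)).2
    linarith
  · rw [Finset.card_product, hcA, hcB]; push_cast; ring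


lemma lim_exp {c ε : ℝ} (hc : 0 < c) (hε : 0 < ε) :
    Tendsto (fun x : ℝ => x ^ 2 * Real.exp (-c * x ^ ε)) atTop (𝓝 0) := by
  have h := (tendsto_rpow_mul_exp_neg_mul_atTop_nhds_zero (2 / ε) c hc).comp (tendsto_rpow_atTop hε)
  refine h.congr' ?_
  filter_upwards [eventually_ge_atTop 0] with x hx
  simp only [Function.comp]
  rw [← Real.rpow_mul hx, mul_div_cancel₀ _ hε.ne']
  norm_num

lemma lim_exp' {c ε : ℝ} (hc : 0 < c) (hε : 0 < ε) :
    Tendsto (fun x : ℝ => Real.exp (-c * x ^ ε)) atTop (𝓝 0) := by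
  refine Real.tendsto_exp_atBot.comp ?_
  exact (tendsto_rpow_atTop hε).const_mul_atTop_of_neg (by linarith)

lemma qf_bound {δ ρ' M : ℝ} {d n c : ℕ} (h0 : 0 < δ) (h1 : δ ≤ 1 / 4) (hd : 0 < d) (hn : 0 < n)
    (hM : 1 ≤ M) (hr : (d : ℝ) ^ 2 / n ≤ 1 + ρ' * Real.log M) (hc : (1 - δ) * n ≤ c)
    (hK : (1 + 6 * δ) ^ 2 * (1 + δ) / (1 - δ) ^ 4 * ρ' / 8 ≤ 1 - 2 * δ) :
    Real.exp (-((1 + 6 * δ) ^ 2 * (1 + δ) / (1 - δ) ^ 4 / 8 + (1 + 1 / δ) / 2)) / 3 * M ^ (-(1 - 2 * δ)) ≤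
      qf ((1 + 6 * δ) / 2 * √d / √((1 - δ) ^ 3 * c / d)) := by
  have hd' : (0 : ℝ) < d := by positivity
  have hn' : (0 : ℝ) < n := by positivity
  have hδ : 0 < 1 - δ := by linarith
  have hc' : (0 : ℝ) < c := lt_of_lt_of_le (by positivity) hc
  have hM0 : 0 < M := by linarith
  have hlog : 0 ≤ Real.log M := Real.log_nonneg hM
  set x := (1 + 6 * δ) / 2 * √d / √((1 - δ) ^ 3 * c / d) with hx
  set K := (1 + 6 * δ) ^ 2 * (1 + δ) / (1 - δ) ^ 4 with hKdef
  have hKp : 0 < K := by positivity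
  have hx2 : (1 + δ) * x ^ 2 ≤ K / 4 * ((d : ℝ) ^ 2 / n) := by
    have e1 : x ^ 2 = (1 + 6 * δ) ^ 2 / 4 * (d : ℝ) ^ 2 / ((1 - δ) ^ 3 * c) := by
      rw [hx, div_pow, mul_pow, Real.sq_sqrt hd'.le, Real.sq_sqrt (by positivity)]
      field_simp
      norm_num
    rw [e1]
    calc (1 + δ) * ((1 + 6 * δ) ^ 2 / 4 * (d : ℝ) ^ 2 / ((1 - δ) ^ 3 * c))
        ≤ (1 + δ) * ((1 + 6 * δ) ^ 2 / 4 * (d : ℝ) ^ 2 / ((1 - δ) ^ 3 * ((1 - δ) * n))) := by gcongr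
      _ = _ := by rw [hKdef]; field_simp
  have hy : (x + 1) ^ 2 ≤ (1 + δ) * x ^ 2 + (1 + 1 / δ) := by
    have : (1 + δ) * x ^ 2 + (1 + 1 / δ) - (x + 1) ^ 2 = (δ * x - 1) ^ 2 / δ := by field_simp; ring
    have h2 : 0 ≤ (δ * x - 1) ^ 2 / δ := by positivity
    linarith
  have hz : K / 4 * ((d : ℝ) ^ 2 / n) ≤ K / 4 * (1 + ρ' * Real.log M) := by gcongr
  have hw : K * ρ' / 8 * Real.log M ≤ (1 - 2 * δ) * Real.log M := by gcongr
  unfold qf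
  rw [Real.rpow_def_of_pos hM0, div_mul_eq_mul_div, ← Real.exp_add]
  gcongr
  linarith

lemma kb_bound {δ M : ℝ} {d m : ℕ} (h0 : 0 < δ) (h1 : δ ≤ 1 / 4) (hM : 1 ≤ M)
    (hd : M ≤ (d : ℝ) ^ 2) (hm1 : M ^ (1 - δ) / 2 ≤ m) (hm2 : m ≤ M ^ (1 - δ)) :
    kb δ δ d (2 * m) ≤ 10 * Real.exp (-(δ ^ 2 / 100) * M ^ δ) := by
  have hM0 : 0 < M := by linarith
  have hp : 0 < M ^ δ := by positivity
  have hdM : M ^ δ ≤ d := by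
    refine (pow_le_pow_iff_left₀ (by positivity) (by positivity) two_ne_zero).mp (le_trans ?_ hd)
    rw [← Real.rpow_natCast, ← Real.rpow_mul hM0.le]
    calc _ ≤ M ^ (1 : ℝ) := Real.rpow_le_rpow_of_exponent_le hM (by push_cast; linarith)
      _ = M := Real.rpow_one _
  have hd' : (0 : ℝ) < d := by linarith
  have hmM : M ^ δ ≤ M ^ (1 - δ) := Real.rpow_le_rpow_of_exponent_le hM (by linarith)
  have hsplit : M ^ (1 - δ) = M / M ^ δ := by rw [Real.rpow_sub hM0, Real.rpow_one]
  have a1 : Real.exp (-δ ^ 2 * d / 16) ≤ Real.exp (-(δ ^ 2 / 100) * M ^ δ) := by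
    apply Real.exp_le_exp.mpr
    have : δ ^ 2 * M ^ δ ≤ δ ^ 2 * d := by gcongr
    nlinarith [mul_pos (pow_pos h0 2) hp]
  have a2 : Real.exp (-δ ^ 2 * (2 * m : ℕ) / 16) ≤ Real.exp (-(δ ^ 2 / 100) * M ^ δ) := by
    apply Real.exp_le_exp.mpr
    push_cast
    have : δ ^ 2 * M ^ δ ≤ δ ^ 2 * (2 * m) := by gcongr; linarith
    nlinarith [mul_pos (pow_pos h0 2) hp]
  have hVp : 0 < Vf δ d (2 * m) := by unfold Vf; positivity
  have hV : Vf δ d (2 * m) ≤ 50 / M ^ δ := by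
    unfold Vf
    have e1 : (18 : ℝ) / d ≤ 18 / M ^ δ := by gcongr
    have e2 : (1 + 2 * δ) ^ 3 * (2 * (2 * m : ℕ)) / (d : ℝ) ^ 2 ≤ 32 / M ^ δ := by
      calc _ ≤ (2 : ℝ) ^ 3 * (2 * (2 * M ^ (1 - δ))) / M := by
            push_cast
            gcongr
            linarith
        _ = _ := by rw [hsplit]; field_simp; norm_num
    calc _ ≤ 18 / M ^ δ + 32 / M ^ δ := add_le_add e1 e2
      _ = _ := by ring
  have a3 : Real.exp (-δ ^ 2 / (2 * Vf δ d (2 * m))) ≤ Real.exp (-(δ ^ 2 / 100) * M ^ δ) := by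
    apply Real.exp_le_exp.mpr
    rw [neg_div, neg_mul]
    apply neg_le_neg
    calc δ ^ 2 / 100 * M ^ δ = δ ^ 2 / (2 * (50 / M ^ δ)) := by field_simp; norm_num
      _ ≤ _ := by gcongr
  unfold kb
  linarith

set_option maxHeartbeats 2000000 in
lemma lower_det {δ ρ' M : ℝ} {d n : ℕ} (h0 : 0 < δ) (h1 : δ ≤ 1 / 4) (hρ : 0 ≤ ρ')
    (hMdef : M = min (n : ℝ) ((d : ℝ) ^ 2))
    (hM : 1 ≤ M) (hM2 : 2 / δ ≤ M ^ δ) (hr : (d : ℝ) ^ 2 ≤ ρ' * (n * Real.log n))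
    (hK : (1 + 6 * δ) ^ 2 * (1 + δ) / (1 - δ) ^ 4 * ρ' / 8 ≤ 1 - 2 * δ) :
    (gaussianModel d n).real (PRcross d n) ≤
      2 * Real.exp (-(Real.exp (-((1 + 6 * δ) ^ 2 * (1 + δ) / (1 - δ) ^ 4 / 8 + (1 + 1 / δ) / 2)) / 6) * M ^ δ) +
        13 * (M ^ 2 * Real.exp (-(δ ^ 2 / 100) * M ^ δ)) := by
  have hM0 : 0 < M := by linarith
  have hMn : M ≤ n := hMdef ▸ min_le_left _ _
  have hMd : M ≤ (d : ℝ) ^ 2 := hMdef ▸ min_le_right _ _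
  have hn' : (0 : ℝ) < n := by linarith
  have hn : 0 < n := by exact_mod_cast hn'
  have hd : 0 < d := by
    rcases Nat.eq_zero_or_pos d with h | h
    · subst h; norm_num at hMd; linarith
    · exact h
  have hp : 0 < M ^ δ := by positivity
  have hsplit : M ^ (1 - δ) = M / M ^ δ := by rw [Real.rpow_sub hM0, Real.rpow_one]
  have hmM : M ^ δ ≤ M ^ (1 - δ) := Real.rpow_le_rpow_of_exponent_le hM (by linarith)
  have h8 : 8 ≤ M ^ δ := by
    refine le_trans ?_ hM2
    rw [le_div_iff₀ h0]; linarith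
  set m := ⌊M ^ (1 - δ)⌋₊ with hm
  have hm2 : (m : ℝ) ≤ M ^ (1 - δ) := Nat.floor_le (by positivity)
  have hm1 : M ^ (1 - δ) / 2 ≤ m := by
    have := Nat.lt_floor_add_one (M ^ (1 - δ))
    rw [← hm] at this
    linarith
  have hmδ : 2 * (m : ℝ) ≤ δ * M := by
    refine le_trans (mul_le_mul_of_nonneg_left hm2 (by norm_num)) ?_
    rw [hsplit, ← mul_div_assoc, div_le_iff₀ hp]
    rw [div_le_iff₀ h0] at hM2
    nlinarith
  have hmn : 2 * m ≤ n := by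
    have : 2 * (m : ℝ) ≤ n := by nlinarith
    exact_mod_cast this
  obtain ⟨c, hcn⟩ := Nat.exists_eq_add_of_le' hmn
  have hcn' : (n : ℝ) = c + 2 * m := by rw [hcn]; push_cast; ring
  have hc1 : (1 - δ) * n ≤ c := by nlinarith
  have hc' : (0 : ℝ) < c := lt_of_lt_of_le (mul_pos (by linarith) hn') hc1
  have hc : 0 < c := by exact_mod_cast hc'
  have hcM : M / 2 ≤ c := by nlinarith
  have hmle : (m : ℝ) ≤ M := by nlinarith
  have hlog : 0 ≤ Real.log M := Real.log_nonneg hM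
  have hratio : (d : ℝ) ^ 2 / n ≤ 1 + ρ' * Real.log M := by
    rw [div_le_iff₀ hn']
    rcases le_total (n : ℝ) ((d : ℝ) ^ 2) with h | h
    · have : M = n := by rw [hMdef, min_eq_left h]
      rw [this]
      nlinarith
    · have : 0 ≤ ρ' * Real.log M * n := by positivity
      linarith
  have Q := qf_bound h0 h1 hd hn hM hratio hc1 hK
  have KB := kb_bound h0 h1 hM hMd hm1 hm2
  have main := lower_bd hd hc hcn.symm h0 (by linarith : δ ≤ 1 / 2)
  set q := qf ((1 + 6 * δ) / 2 * √d / √((1 - δ) ^ 3 * c / d)) with hq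
  set c1 := Real.exp (-((1 + 6 * δ) ^ 2 * (1 + δ) / (1 - δ) ^ 4 / 8 + (1 + 1 / δ) / 2)) with hc1def
  have hc1p : 0 < c1 := Real.exp_pos _
  have hq1 : 0 ≤ 1 - q := by
    rw [hq]
    unfold qf
    have : ∀ y : ℝ, Real.exp (-(y + 1) ^ 2 / 2) ≤ 1 := fun y =>
      Real.exp_le_one_iff.mpr (by have := sq_nonneg (y + 1); linarith)
    have := this ((1 + 6 * δ) / 2 * √d / √((1 - δ) ^ 3 * c / d))
    linarith
  have t1 : (1 - q) ^ m ≤ Real.exp (-(c1 / 6) * M ^ δ) := by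
    calc (1 - q) ^ m ≤ (Real.exp (-q)) ^ m := by
          gcongr
          have := Real.add_one_le_exp (-q)
          linarith
      _ = Real.exp (-(m * q)) := by rw [← Real.exp_nat_mul]; ring_nf
      _ ≤ _ := by
          apply Real.exp_le_exp.mpr
          rw [neg_mul]
          apply neg_le_neg
          calc c1 / 6 * M ^ δ = (M ^ (1 - δ) / 2) * (c1 / 3 * M ^ (-(1 - 2 * δ))) := by
                have : M ^ δ = M ^ (1 - δ) * M ^ (-(1 - 2 * δ)) := by
                  rw [← Real.rpow_add hM0]; ring_nf
                rw [this]; ring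
            _ ≤ m * q := by gcongr
  have hdM : M ^ δ ≤ d := by
    refine (pow_le_pow_iff_left₀ (by positivity) (by positivity) two_ne_zero).mp (le_trans ?_ hMd)
    rw [← Real.rpow_natCast, ← Real.rpow_mul hM0.le]
    calc _ ≤ M ^ (1 : ℝ) := Real.rpow_le_rpow_of_exponent_le hM (by push_cast; linarith)
      _ = M := Real.rpow_one _
  have hpM : M ^ δ ≤ M := by
    calc _ ≤ M ^ (1 : ℝ) := Real.rpow_le_rpow_of_exponent_le hM (by linarith)
      _ = M := Real.rpow_one _
  have a1 : Real.exp (-δ ^ 2 * d / 16) ≤ Real.exp (-(δ ^ 2 / 100) * M ^ δ) := by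
    apply Real.exp_le_exp.mpr
    have : δ ^ 2 * M ^ δ ≤ δ ^ 2 * d := by gcongr
    nlinarith [mul_pos (pow_pos h0 2) hp]
  have a2 : Real.exp (-δ ^ 2 * c / 16) ≤ Real.exp (-(δ ^ 2 / 100) * M ^ δ) := by
    apply Real.exp_le_exp.mpr
    have : δ ^ 2 * M ^ δ ≤ δ ^ 2 * (2 * c) := by gcongr; linarith
    nlinarith [mul_pos (pow_pos h0 2) hp]
  have hE := Real.exp_pos (-(δ ^ 2 / 100) * M ^ δ)
  have t2 : (m : ℝ) ^ 2 * kb δ δ d (2 * m) ≤ M ^ 2 * (10 * Real.exp (-(δ ^ 2 / 100) * M ^ δ)) := by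
    have : 0 ≤ kb δ δ d (2 * m) := by unfold kb; positivity
    gcongr
  have t3 : (m : ℝ) * (2 * Real.exp (-δ ^ 2 * d / 16) + Real.exp (-δ ^ 2 * c / 16)) ≤
      M ^ 2 * (3 * Real.exp (-(δ ^ 2 / 100) * M ^ δ)) := by
    have : (m : ℝ) ≤ M ^ 2 := by nlinarith
    gcongr
    linarith
  linarith

lemma lower_tendsto {ρ' : ℝ} (hρ0 : 0 ≤ ρ') (hρ8 : ρ' < 8) (n d : ℕ → ℕ) (hn : Tendsto n atTop atTop)
    (hd : Tendsto d atTop atTop)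
    (hr : ∀ᶠ m in atTop, (d m : ℝ) ^ 2 ≤ ρ' * (n m * Real.log (n m))) :
    Tendsto (fun m => (gaussianModel (d m) (n m)).real (PRcross (d m) (n m))) atTop (𝓝 0) := by
  obtain ⟨δ, h0, h1, hK⟩ : ∃ δ : ℝ, 0 < δ ∧ δ ≤ 1 / 4 ∧
      (1 + 6 * δ) ^ 2 * (1 + δ) / (1 - δ) ^ 4 * ρ' / 8 ≤ 1 - 2 * δ := by
    have hc : ContinuousAt (fun δ : ℝ => (1 + 6 * δ) ^ 2 * (1 + δ) / (1 - δ) ^ 4 * ρ' / 8 - (1 - 2 * δ)) 0 := by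
      refine ContinuousAt.sub (ContinuousAt.div_const (ContinuousAt.mul (ContinuousAt.div ?_ ?_ ?_) ?_) _) ?_
      all_goals first | fun_prop | norm_num
    have h2 := hc.eventually_lt_const (u := 0) (by norm_num; linarith)
    have h3 : ∀ᶠ δ in 𝓝[>] (0 : ℝ), δ < 1 / 4 := 
      (eventually_lt_nhds (by norm_num : (0 : ℝ) < 1 / 4)).filter_mono nhdsWithin_le_nhds
    obtain ⟨δ, e1, e2, e3⟩ := ((h2.filter_mono nhdsWithin_le_nhds).and
      (h3.and (eventually_mem_nhdsWithin (s := Set.Ioi (0 : ℝ))))).exists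
    exact ⟨δ, e3, e2.le, by linarith⟩
  set M : ℕ → ℝ := fun m => min (n m : ℝ) ((d m : ℝ) ^ 2) with hMdef
  have hM : Tendsto M atTop atTop := by
    have t1 : Tendsto (fun m => (n m : ℝ)) atTop atTop := tendsto_natCast_atTop_atTop.comp hn
    have t2 : Tendsto (fun m => (d m : ℝ) ^ 2) atTop atTop :=
      (tendsto_pow_atTop two_ne_zero).comp (tendsto_natCast_atTop_atTop.comp hd)
    rw [tendsto_atTop] at *
    intro b
    filter_upwards [t1 b, t2 b] with m h1 h2 using le_min h1 h2
  set c1 := Real.exp (-((1 + 6 * δ) ^ 2 * (1 + δ) / (1 - δ) ^ 4 / 8 + (1 + 1 / δ) / 2)) / 6 with hc1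
  have hc1p : 0 < c1 := by positivity
  have L1 := ((lim_exp' hc1p h0).comp hM).const_mul 2
  have L2 := ((lim_exp (by positivity : 0 < δ ^ 2 / 100) h0).comp hM).const_mul 13
  have L3 := L1.add L2
  simp only [mul_zero, add_zero] at L3
  refine squeeze_zero' (Eventually.of_forall fun _ => measureReal_nonneg) ?_ L3
  have hM2 := ((tendsto_rpow_atTop h0).comp hM).eventually_ge_atTop (2 / δ)
  filter_upwards [hr, hM2, hM.eventually_ge_atTop 1] with m e1 e2 e3
  exact lower_det h0 h1 hρ0 rfl e3 e2 e1 hK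


lemma upper_det {δ ρ' η : ℝ} {d n : ℕ} (h0 : 0 < δ) (h1 : δ ≤ 1 / 5) (hρ : 8 < ρ') (hd0 : 0 < d)
    (hn : 1 ≤ Real.log n)
    (hr : ρ' * (n * Real.log n) ≤ (d : ℝ) ^ 2)
    (hη : Real.log n / (n : ℝ) ^ (1 / 2 : ℝ) ≤ η)
    (hK : 4 * (2 + δ) * (1 + 2 * δ) ^ 3 / ρ' + 36 * (2 + δ) * η ≤ (1 - 5 * δ) ^ 2) :
    (gaussianModel d n).real (PRcross d n)ᶜ ≤
      8 * ((n : ℝ) ^ 2 * Real.exp (-(δ ^ 2 / 16) * (n : ℝ) ^ (1 / 2 : ℝ))) + 2 * (n : ℝ) ^ (-δ) := by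
  have hd' : (0 : ℝ) < d := by positivity
  have hnp : 0 < n := by
    rcases Nat.eq_zero_or_pos n with h | h
    · subst h; norm_num at hn
    · exact h
  have hn' : (0 : ℝ) < n := by positivity
  have hn1 : (1 : ℝ) ≤ n := by exact_mod_cast hnp
  have hs : 0 < (n : ℝ) ^ (1 / 2 : ℝ) := by positivity
  have hss : ((n : ℝ) ^ (1 / 2 : ℝ)) ^ 2 = n := by
    rw [← Real.rpow_natCast, ← Real.rpow_mul hn'.le]; norm_num
  have hsd : (n : ℝ) ^ (1 / 2 : ℝ) ≤ d := by
    refine (pow_le_pow_iff_left₀ (by positivity) (by positivity) two_ne_zero).mp ?_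
    rw [hss]
    refine le_trans ?_ hr
    have : (n : ℝ) ≤ n * Real.log n := by nlinarith
    nlinarith
  have hsn : (n : ℝ) ^ (1 / 2 : ℝ) ≤ n := by
    calc _ ≤ (n : ℝ) ^ (1 : ℝ) := Real.rpow_le_rpow_of_exponent_le hn1 (by norm_num)
      _ = n := Real.rpow_one _
  have a1 : Real.exp (-δ ^ 2 * d / 16) ≤ Real.exp (-(δ ^ 2 / 16) * (n : ℝ) ^ (1 / 2 : ℝ)) := by
    apply Real.exp_le_exp.mpr
    have : δ ^ 2 * (n : ℝ) ^ (1 / 2 : ℝ) ≤ δ ^ 2 * d := by gcongr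
    linarith
  have a2 : Real.exp (-δ ^ 2 * n / 16) ≤ Real.exp (-(δ ^ 2 / 16) * (n : ℝ) ^ (1 / 2 : ℝ)) := by
    apply Real.exp_le_exp.mpr
    have : δ ^ 2 * (n : ℝ) ^ (1 / 2 : ℝ) ≤ δ ^ 2 * n := by gcongr
    linarith
  have hV : 0 < Vf δ d n := by unfold Vf; positivity
  have hVlog : Vf δ d n * Real.log n ≤ 18 * η + 2 * (1 + 2 * δ) ^ 3 / ρ' := by
    unfold Vf
    have e1 : 18 / (d : ℝ) * Real.log n ≤ 18 * η := by
      have : Real.log n / d ≤ Real.log n / (n : ℝ) ^ (1 / 2 : ℝ) := by gcongr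
      calc _ = 18 * (Real.log n / d) := by ring
        _ ≤ _ := by gcongr; exact this.trans hη
    have e2 : (1 + 2 * δ) ^ 3 * (2 * n) / (d : ℝ) ^ 2 * Real.log n ≤ 2 * (1 + 2 * δ) ^ 3 / ρ' := by
      have : (n * Real.log n) / (d : ℝ) ^ 2 ≤ 1 / ρ' := by
        rw [div_le_div_iff₀ (by positivity) (by linarith)]
        linarith
      calc _ = 2 * (1 + 2 * δ) ^ 3 * ((n * Real.log n) / (d : ℝ) ^ 2) := by ring
        _ ≤ 2 * (1 + 2 * δ) ^ 3 * (1 / ρ') := by gcongr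
        _ = _ := by ring
    rw [add_mul]
    exact add_le_add e1 e2
  have a3 : Real.exp (-(1 - 5 * δ) ^ 2 / (2 * Vf δ d n)) ≤ (n : ℝ) ^ (-(2 + δ)) := by
    rw [Real.rpow_def_of_pos hn']
    apply Real.exp_le_exp.mpr
    rw [div_le_iff₀ (by positivity)]
    have : (2 * (2 + δ)) * (Vf δ d n * Real.log n) ≤ (2 * (2 + δ)) * (18 * η + 2 * (1 + 2 * δ) ^ 3 / ρ') := by
      gcongr
    have e : (2 * (2 + δ)) * (18 * η + 2 * (1 + 2 * δ) ^ 3 / ρ') =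
      4 * (2 + δ) * (1 + 2 * δ) ^ 3 / ρ' + 36 * (2 + δ) * η := by ring
    linarith
  have a4 : (n : ℝ) ^ 2 * (n : ℝ) ^ (-(2 + δ)) = (n : ℝ) ^ (-δ) := by
    rw [← Real.rpow_natCast, ← Real.rpow_add hn']; norm_num
  refine (upper_bd hd0 h0 h1).trans ?_
  unfold kb
  calc _ ≤ (n : ℝ) ^ 2 * (7 * Real.exp (-(δ ^ 2 / 16) * (n : ℝ) ^ (1 / 2 : ℝ)) +
      Real.exp (-(δ ^ 2 / 16) * (n : ℝ) ^ (1 / 2 : ℝ)) + 2 * (n : ℝ) ^ (-(2 + δ))) := by gcongr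
    _ = _ := by rw [← a4]; ring

lemma upper_tendsto {ρ' : ℝ} (hρ8 : 8 < ρ') (n d : ℕ → ℕ) (hn : Tendsto n atTop atTop)
    (hd : Tendsto d atTop atTop)
    (hr : ∀ᶠ m in atTop, ρ' * (n m * Real.log (n m)) ≤ (d m : ℝ) ^ 2) :
    Tendsto (fun m => (gaussianModel (d m) (n m)).real (PRcross (d m) (n m))ᶜ) atTop (𝓝 0) := by
  obtain ⟨δ, h0, h1, hK⟩ : ∃ δ : ℝ, 0 < δ ∧ δ ≤ 1 / 5 ∧
      4 * (2 + δ) * (1 + 2 * δ) ^ 3 / ρ' < (1 - 5 * δ) ^ 2 := by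
    have hc : Continuous (fun δ : ℝ => 4 * (2 + δ) * (1 + 2 * δ) ^ 3 / ρ' - (1 - 5 * δ) ^ 2) := by
      fun_prop
    have h8 : 8 / ρ' < 1 := by rw [div_lt_one (by linarith)]; exact hρ8
    have h2 := (hc.continuousAt (x := 0)).eventually_lt_const (u := 0) (by norm_num; linarith)
    have h3 : ∀ᶠ δ in 𝓝[>] (0 : ℝ), δ < 1 / 5 :=
      (eventually_lt_nhds (by norm_num : (0 : ℝ) < 1 / 5)).filter_mono nhdsWithin_le_nhds
    obtain ⟨δ, e1, e2, e3⟩ := ((h2.filter_mono nhdsWithin_le_nhds).and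
      (h3.and (eventually_mem_nhdsWithin (s := Set.Ioi (0 : ℝ))))).exists
    exact ⟨δ, e3, e2.le, by linarith⟩
  set η := ((1 - 5 * δ) ^ 2 - 4 * (2 + δ) * (1 + 2 * δ) ^ 3 / ρ') / (36 * (2 + δ)) with hη
  have hηp : 0 < η := div_pos (by linarith) (by positivity)
  have hK' : 4 * (2 + δ) * (1 + 2 * δ) ^ 3 / ρ' + 36 * (2 + δ) * η ≤ (1 - 5 * δ) ^ 2 := by
    rw [hη, mul_div_cancel₀ _ (by positivity)]; linarith
  have t1 : Tendsto (fun m => (n m : ℝ)) atTop atTop := tendsto_natCast_atTop_atTop.comp hn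
  have L1 := ((lim_exp (by positivity : 0 < δ ^ 2 / 16) (by norm_num : (0 : ℝ) < 1 / 2)).comp t1).const_mul 8
  have L2 := ((tendsto_rpow_neg_atTop h0).comp t1).const_mul 2
  have L3 := L1.add L2
  simp only [mul_zero, add_zero] at L3
  refine squeeze_zero' (Eventually.of_forall fun _ => measureReal_nonneg) ?_ L3
  have E1 := (Real.tendsto_log_atTop.comp t1).eventually_ge_atTop 1
  have E2 := ((isLittleO_log_rpow_atTop (by norm_num : (0 : ℝ) < 1 / 2)).tendsto_div_nhds_zero.comp t1).eventually_le_const hηp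
  filter_upwards [hr, E1, E2, hd.eventually_gt_atTop 0] with m e1 e2 e3 e4
  exact upper_det h0 h1 hρ8 e4 e2 e1 e3 hK'

/-- **Retrieval threshold for correlation matrix memory**: in the limiting regime
`n, d → ∞` with `d²/(n log n) → ρ ∈ [0,∞]`, the probability of perfect top-1
retrieval by `W^×` tends to `1` if `ρ > 8` and to `0` if `ρ < 8`. -/
theorem correlation_memory_threshold (ρ : ENNReal)
    (n d : ℕ → ℕ) (hn : Tendsto n atTop atTop) (hd : Tendsto d atTop atTop)
    (hρ : Tendsto (fun m => ENNReal.ofReal ((d m : ℝ) ^ 2 / (n m * Real.log (n m))))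
      atTop (𝓝 ρ)) :
    ((8 : ENNReal) < ρ →
      Tendsto (fun m => gaussianModel (d m) (n m) (PRcross (d m) (n m))) atTop
        (𝓝 (1 : ENNReal))) ∧
    (ρ < (8 : ENNReal) →
      Tendsto (fun m => gaussianModel (d m) (n m) (PRcross (d m) (n m))) atTop
        (𝓝 (0 : ENNReal))) := by
  have t1 : Tendsto (fun m => (n m : ℝ)) atTop atTop := tendsto_natCast_atTop_atTop.comp hn
  have hpos : ∀ᶠ m in atTop, 0 < (n m : ℝ) * Real.log (n m) := by
    filter_upwards [t1.eventually_gt_atTop 1] with m hm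
    exact mul_pos (by linarith) (Real.log_pos hm)
  constructor
  · intro h
    obtain ⟨r, hr1, hr2⟩ := ENNReal.lt_iff_exists_nnreal_btwn.mp h
    have hr8 : (8 : ℝ) < r := by exact_mod_cast hr1
    have hev : ∀ᶠ m in atTop, (r : ℝ) * (n m * Real.log (n m)) ≤ (d m : ℝ) ^ 2 := by
      filter_upwards [hρ.eventually_const_lt hr2, hpos] with m h1 h2
      rw [← ENNReal.ofReal_coe_nnreal, ENNReal.ofReal_lt_ofReal_iff_of_nonneg r.coe_nonneg] at h1
      exact ((lt_div_iff₀ h2).mp h1).le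
    have T := upper_tendsto hr8 n d hn hd hev
    have T2 : Tendsto (fun m => ENNReal.ofReal
        (1 - (gaussianModel (d m) (n m)).real (PRcross (d m) (n m))ᶜ)) atTop (𝓝 1) := by
      have := ENNReal.tendsto_ofReal (tendsto_const_nhds (x := (1 : ℝ)) |>.sub T)
      simpa using this
    refine tendsto_of_tendsto_of_tendsto_of_le_of_le T2 tendsto_const_nhds ?_ (fun m => prob_le_one)
    intro m
    have h1 := measureReal_union_le (μ := gaussianModel (d m) (n m)) (PRcross (d m) (n m)) (PRcross (d m) (n m))ᶜ
    rw [Set.union_compl_self, probReal_univ] at h1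
    simp only
    rw [← ofReal_measureReal]
    exact ENNReal.ofReal_le_ofReal (by linarith)
  · intro h
    obtain ⟨r, hr1, hr2⟩ := ENNReal.lt_iff_exists_nnreal_btwn.mp h
    have hr8 : (r : ℝ) < 8 := by exact_mod_cast hr2
    have hev : ∀ᶠ m in atTop, (d m : ℝ) ^ 2 ≤ (r : ℝ) * (n m * Real.log (n m)) := by
      filter_upwards [hρ.eventually_lt_const hr1, hpos] with m h1 h2
      rw [← ENNReal.ofReal_coe_nnreal, ENNReal.ofReal_lt_ofReal_iff_of_nonneg (by positivity)] at h1
      exact ((div_lt_iff₀ h2).mp h1).le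
    have T := ENNReal.tendsto_ofReal (lower_tendsto r.coe_nonneg hr8 n d hn hd hev)
    simpa using T

end
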